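/- Let H be a virtually-full, virtually-coabelian subgroup of corank r of a direct product D = Γ_1 × … × Γ_n, where n ≥ 3 and each Γ_i is finitely presented. For each i, let (α_i, ρ_i) be an area-radius pair for some finite presentation of Γ_i. Define α(l) = max({l²} ∪ {α_i(l) : 1 ≤ i ≤ n}) and ρ(l) = max({l} ∪ {ρ_i(l) : 1 ≤ i ≤ n}). Then the function l ↦ ρ(l)^{2r}·α(l) is an isoperimetric function for H. -/

import Mathlib

open Subgroup

/-- Reduced word length in a free group. -/
noncomputable def fgNorm {X : Type*} (w : FreeGroup X) : ℕ :=
  @FreeGroup.norm X (Classical.decEq X) w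

/-- `w` is a product of exactly `N` conjugates of elements of `R ∪ R⁻¹`. -/
def ExprOf {X : Type*} (R : Set (FreeGroup X)) (w : FreeGroup X) (N : ℕ) : Prop :=
  ∃ l : List (FreeGroup X × FreeGroup X),
    l.length = N ∧ (∀ p ∈ l, p.2 ∈ R ∨ p.2⁻¹ ∈ R) ∧
    (l.map fun p => p.1 * p.2 * p.1⁻¹).prod = w

/-- The area of a null-homotopic word: the least number of conjugates of relators needed. -/
noncomputable def area {X : Type*} (R : Set (FreeGroup X)) (w : FreeGroup X) : ℕ :=
  sInf {N | ExprOf R w N}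

/-- The Dehn function of the presentation with relator set `R`. -/
noncomputable def dehn {X : Type*} (R : Set (FreeGroup X)) (l : ℕ) : ℕ :=
  sSup {A | ∃ w ∈ Subgroup.normalClosure R, fgNorm w ≤ l ∧ A = area R w}

/-- `f ⪯ g`. -/
def Preceq (f g : ℕ → ℕ) : Prop := ∃ C : ℕ, ∀ l, f l ≤ C * g (C * l + C) + C * l + C

/-- `f ≃ g`. -/
def FEquiv (f g : ℕ → ℕ) : Prop := Preceq f g ∧ Preceq g f

/-- `φ` realizes `⟨X | R⟩` as a presentation of `G`. -/
def Presents {X : Type*} {G : Type*} [Group G] (R : Set (FreeGroup X))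
    (φ : FreeGroup X →* G) : Prop :=
  Function.Surjective φ ∧ φ.ker = Subgroup.normalClosure R

def FinitelyPresentedGroup (G : Type*) [Group G] : Prop :=
  ∃ (X : Type) (_ : Finite X) (R : Set (FreeGroup X)) (φ : FreeGroup X →* G),
    R.Finite ∧ Presents R φ

/-- `f` is an isoperimetric function for `G` : the Dehn function of every finite
presentation of `G` is `⪯ f`. -/
def IsIsopFunction (G : Type*) [Group G] (f : ℕ → ℕ) : Prop :=
  ∀ (X : Type) (R : Set (FreeGroup X)) (φ : FreeGroup X →* G),
    Finite X → R.Finite → Presents R φ → Preceq (dehn R) f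

/-- `(α, ρ)` is an area-radius pair for the presentation with relator set `R`. -/
def IsAreaRadiusPair {X : Type*} (R : Set (FreeGroup X)) (α ρ : ℕ → ℕ) : Prop :=
  ∀ w ∈ Subgroup.normalClosure R, ∀ l : ℕ, fgNorm w ≤ l →
    ∃ L : List (FreeGroup X × FreeGroup X), L.length ≤ α l ∧
      (∀ p ∈ L, (p.2 ∈ R ∨ p.2⁻¹ ∈ R) ∧ fgNorm p.1 ≤ ρ l) ∧
      (L.map fun p => p.1 * p.2 * p.1⁻¹).prod = w

/-- `g` is a product of at most `k` elements of `S ∪ S⁻¹`. -/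
def WordLe {G : Type*} [Group G] (S : Set G) (g : G) (k : ℕ) : Prop :=
  ∃ l : List G, l.length ≤ k ∧ (∀ x ∈ l, x ∈ S ∨ x⁻¹ ∈ S) ∧ l.prod = g

/-- Word length of `g` with respect to the generating set `S`. -/
noncomputable def wordLength {G : Type*} [Group G] (S : Set G) (g : G) : ℕ :=
  sInf {k | WordLe S g k}

open scoped TensorProduct


namespace IsopProof

section Fill

variable {F F' : Type*} [Group F] [Group F']

/-- `Fill R S n w`: `w` is a product of at most `n` conjugates `x * r * x⁻¹` with `r ∈ R ∪ R⁻¹`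
and `x ∈ S`. -/
inductive Fill (R S : Set F) : ℕ → F → Prop
  | one (n : ℕ) : Fill R S n 1
  | cons {n : ℕ} {w x r : F} (hr : r ∈ R ∨ r⁻¹ ∈ R) (hx : x ∈ S) (hw : Fill R S n w) :
      Fill R S (n + 1) (x * r * x⁻¹ * w)

variable {R R' S S' : Set F} {n m : ℕ} {u v w : F}

theorem Fill.mono (h : Fill R S n w) (hR : R ⊆ R') (hS : S ⊆ S') (hn : n ≤ m) :
    Fill R' S' m w := by
  induction h generalizing m with
  | one k => exact .one _
  | cons hr hx _ ih =>
    obtain ⟨k, rfl⟩ : ∃ k, m = k + 1 := ⟨m - 1, by omega⟩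
    exact .cons (hr.imp (@hR _) (@hR _)) (hS hx) (ih (by omega))

theorem Fill.mul (hu : Fill R S n u) (hv : Fill R S m v) : Fill R S (n + m) (u * v) := by
  induction hu with
  | one k => simpa using hv.mono subset_rfl subset_rfl (Nat.le_add_left _ _)
  | cons hr hx _ ih =>
    rw [mul_assoc, Nat.add_right_comm]
    exact .cons hr hx ih

theorem Fill.single {x r : F} (hr : r ∈ R ∨ r⁻¹ ∈ R) (hx : x ∈ S) :
    Fill R S 1 (x * r * x⁻¹) := by
  simpa using Fill.cons hr hx (.one 0)

theorem Fill.inv (h : Fill R S n w) : Fill R S n w⁻¹ := by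
  induction h with
  | one k => simpa using Fill.one k
  | @cons n w x r hr hx _ ih =>
    have h1 : Fill R S 1 (x * r⁻¹ * x⁻¹) := .single (by simpa using hr.symm) hx
    simpa [mul_assoc] using ih.mul h1

theorem Fill.conj (h : Fill R S n w) {y : F} (hy : ∀ x ∈ S, y * x ∈ S') :
    Fill R S' n (y * w * y⁻¹) := by
  induction h with
  | one k => simpa using Fill.one k
  | @cons n w x r hr hx _ ih =>
    have := Fill.cons hr (hy x hx) ih
    simpa [mul_assoc] using this

/-- A map that is multiplicative on conjugates of relators turns a filling into a filling. -/
theorem Fill.bind {R' S' : Set F'} {f : F → F'} (f1 : f 1 = 1)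
    (fmul : ∀ x ∈ S, ∀ r, (r ∈ R ∨ r⁻¹ ∈ R) → ∀ w,
      f (x * r * x⁻¹ * w) = f (x * r * x⁻¹) * f w)
    (hf : ∀ x ∈ S, ∀ r, (r ∈ R ∨ r⁻¹ ∈ R) → Fill R' S' m (f (x * r * x⁻¹)))
    (h : Fill R S n w) : Fill R' S' (n * m) (f w) := by
  induction h with
  | one k => rw [f1]; exact .one _
  | @cons n w x r hr hx _ ih =>
    rw [fmul x hx r hr, add_mul, one_mul, add_comm]
    exact (hf x hx r hr).mul ih

theorem Fill.of_list (L : List (F × F))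
    (hL : ∀ p ∈ L, (p.2 ∈ R ∨ p.2⁻¹ ∈ R) ∧ p.1 ∈ S) :
    Fill R S L.length (L.map fun p => p.1 * p.2 * p.1⁻¹).prod := by
  induction L with
  | nil => exact .one _
  | cons p L ih =>
    simp only [List.map_cons, List.prod_cons, List.length_cons]
    exact .cons (hL p (by simp)).1 (hL p (by simp)).2 (ih fun q hq => hL q (by simp [hq]))

theorem Fill.exists_list (h : Fill R S n w) :
    ∃ L : List (F × F), L.length ≤ n ∧ (∀ p ∈ L, p.2 ∈ R ∨ p.2⁻¹ ∈ R) ∧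
      (L.map fun p => p.1 * p.2 * p.1⁻¹).prod = w := by
  induction h with
  | one k => exact ⟨[], by simp⟩
  | @cons n w x r hr hx _ ih =>
    obtain ⟨L, h1, h2, h3⟩ := ih
    refine ⟨(x, r) :: L, by simpa using h1, ?_, by simp [h3]⟩
    simpa using ⟨hr, by simpa using h2⟩

end Fill

section Norm

variable {X : Type*}

theorem fgNorm_one : fgNorm (1 : FreeGroup X) = 0 := by
  classical
  unfold fgNorm; simp

theorem fgNorm_inv (w : FreeGroup X) : fgNorm w⁻¹ = fgNorm w := by
  unfold fgNorm; exact @FreeGroup.norm_inv_eq X (Classical.decEq X) w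

theorem fgNorm_mul (u v : FreeGroup X) : fgNorm (u * v) ≤ fgNorm u + fgNorm v := by
  unfold fgNorm; exact @FreeGroup.norm_mul_le X (Classical.decEq X) u v

theorem fgNorm_of (x : X) : fgNorm (FreeGroup.of x) = 1 := by
  unfold fgNorm; exact @FreeGroup.norm_of X (Classical.decEq X) x

/-- Induction on the letters of a reduced word. -/
theorem fgNorm_induction {Q : FreeGroup X → ℕ → Prop} (one : Q 1 0)
    (of : ∀ w n x, Q w n → Q (w * FreeGroup.of x) (n + 1))
    (inv : ∀ w n x, Q w n → Q (w * (FreeGroup.of x)⁻¹) (n + 1)) (w : FreeGroup X) :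
    Q w (fgNorm w) := by
  let _ := Classical.decEq X
  have key : ∀ L : List (X × Bool), Q (FreeGroup.mk L) L.length := by
    intro L
    induction L using List.reverseRecOn with
    | nil => exact one
    | append_singleton L a ih =>
      rw [← FreeGroup.mul_mk, List.length_append]
      rcases a with ⟨x, _ | _⟩
      · exact inv _ _ _ ih
      · exact of _ _ _ ih
  have := key w.toWord
  rwa [FreeGroup.mk_toWord] at this

/-- A length function on a group. -/
structure IsLength {G : Type*} [Group G] (N : G → ℕ) : Prop where
  one : N 1 = 0
  inv : ∀ g, N g⁻¹ = N g
  mul : ∀ g h, N (g * h) ≤ N g + N h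

theorem isLength_fgNorm : IsLength (fgNorm : FreeGroup X → ℕ) :=
  ⟨fgNorm_one, fgNorm_inv, fgNorm_mul⟩

variable {G : Type*} [Group G] {N : G → ℕ}

theorem IsLength.comp {G' : Type*} [Group G'] (hN : IsLength N) (f : G' →* G) :
    IsLength (N ∘ f) :=
  ⟨by simp [hN.one], fun g => by simp [hN.inv], fun g h => by simpa using hN.mul _ _⟩

theorem IsLength.pow (hN : IsLength N) (g : G) (k : ℕ) : N (g ^ k) ≤ k * N g := by
  induction k with
  | zero => simp [hN.one]
  | succ k ih =>
    rw [pow_succ, add_mul, one_mul]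
    exact (hN.mul _ _).trans (by gcongr)

theorem IsLength.zpow (hN : IsLength N) (g : G) (k : ℤ) : N (g ^ k) ≤ k.natAbs * N g := by
  rcases Int.natAbs_eq k with h | h
  · rw [h, zpow_natCast, Int.natAbs_natCast]
    exact hN.pow g k.natAbs
  · rw [h, zpow_neg, hN.inv, zpow_natCast, Int.natAbs_neg, Int.natAbs_natCast]
    exact hN.pow g k.natAbs

theorem IsLength.exists_le_fgNorm [Finite X] (hN : IsLength N) (f : FreeGroup X →* G) :
    ∃ c, ∀ w, N (f w) ≤ c * fgNorm w := by
  obtain ⟨c, hc⟩ := (Set.finite_range fun x => N (f (FreeGroup.of x))).bddAbove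
  have hc' : ∀ x, N (f (FreeGroup.of x)) ≤ c := fun x => hc ⟨x, rfl⟩
  refine ⟨c, fgNorm_induction (Q := fun w n => N (f w) ≤ c * n) ?_ ?_ ?_⟩
  · simp [hN.one]
  · intro w n x h
    rw [map_mul, mul_add, mul_one]
    exact (hN.mul _ _).trans (add_le_add h (hc' x))
  · intro w n x h
    rw [map_mul, map_inv, mul_add, mul_one]
    exact (hN.mul _ _).trans (add_le_add h ((hN.inv _).trans_le (hc' x)))

end Norm

section Cocycle

variable {X Ω F : Type*} [Group F]

/-- `p` is a cocycle over the permutation action `e` with values in `F`. -/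
def IsCocycle (e : FreeGroup X →* Equiv.Perm Ω) (p : Ω → FreeGroup X → F) : Prop :=
  ∀ ω u v, p ω (u * v) = p ω u * p ((e u)⁻¹ ω) v

/-- The action of permutations on functions. -/
def permMulAut : Equiv.Perm Ω →* MulAut (Ω → F) where
  toFun σ :=
    { toFun := fun f ω => f (σ⁻¹ ω)
      invFun := fun f ω => f (σ ω)
      left_inv := fun f => by ext; simp
      right_inv := fun f => by ext; simp
      map_mul' := fun f g => rfl }
  map_one' := rfl
  map_mul' σ τ := by
    ext f ω
    simp [mul_inv_rev, Equiv.Perm.mul_apply]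

theorem exists_cocycle (e : FreeGroup X →* Equiv.Perm Ω) (S : Ω → X → F) :
    ∃ p : Ω → FreeGroup X → F, IsCocycle e p ∧ ∀ ω x, p ω (FreeGroup.of x) = S ω x := by
  let f : FreeGroup X →* (Ω → F) ⋊[permMulAut] Equiv.Perm Ω :=
    FreeGroup.lift fun x => ⟨fun ω => S ω x, e (FreeGroup.of x)⟩
  have hf : ∀ u, (f u).right = e u := by
    intro u
    have : SemidirectProduct.rightHom.comp f = e := FreeGroup.ext_hom _ _ fun x => by simp [f]
    exact DFunLike.congr_fun this u
  refine ⟨fun ω u => (f u).left ω, fun ω u v => ?_, fun ω x => by simp [f]⟩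
  simp only [map_mul, SemidirectProduct.mul_left, Pi.mul_apply, hf]
  rfl

variable {e : FreeGroup X →* Equiv.Perm Ω} {p : Ω → FreeGroup X → F}

theorem IsCocycle.one (hp : IsCocycle e p) (ω : Ω) : p ω 1 = 1 := by
  have := hp ω 1 1
  simpa using this

theorem IsCocycle.mul_of_inv (hp : IsCocycle e p) (ω : Ω) (u v : FreeGroup X) :
    p ω (u * v⁻¹) * p ((e (u * v⁻¹))⁻¹ ω) v = p ω u := by
  rw [← hp, inv_mul_cancel_right]

theorem IsCocycle.inv (hp : IsCocycle e p) (ω : Ω) (u : FreeGroup X) :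
    p ω u⁻¹ = (p (e u ω) u)⁻¹ := by
  have := hp.mul_of_inv ω 1 u
  rw [hp.one] at this
  simpa using eq_inv_of_mul_eq_one_left this

theorem IsCocycle.conj (hp : IsCocycle e p) (ω : Ω) (x : FreeGroup X) {r : FreeGroup X}
    (hr : e r = 1) : p ω (x * r * x⁻¹) = p ω x * p ((e x)⁻¹ ω) r * (p ω x)⁻¹ := by
  rw [hp, hp, hp.inv]
  simp [hr]

/-- A cocycle whose values on letters lift the coboundary of `τ` lifts it everywhere. -/
theorem IsCocycle.map_eq {E : Type*} [Group E] (hp : IsCocycle e p) (ψ : F →* E)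
    (φ : FreeGroup X →* E) (τ : Ω → E)
    (h : ∀ ω x, ψ (p ω (FreeGroup.of x)) =
      τ ω * φ (FreeGroup.of x) * (τ ((e (FreeGroup.of x))⁻¹ ω))⁻¹) (ω : Ω) (w : FreeGroup X) :
    ψ (p ω w) = τ ω * φ w * (τ ((e w)⁻¹ ω))⁻¹ := by
  refine fgNorm_induction (Q := fun w _ => ∀ ω, ψ (p ω w) = τ ω * φ w * (τ ((e w)⁻¹ ω))⁻¹)
    ?_ ?_ ?_ w ω
  · simp [hp.one]
  · intro w n x ih ω
    rw [hp, map_mul, ih, h]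
    simp [mul_assoc]
  · intro w n x ih ω
    have h1 := congrArg ψ (hp.mul_of_inv ω w (FreeGroup.of x))
    rw [map_mul, ih, h, ← eq_mul_inv_iff_mul_eq] at h1
    rw [h1]
    simp [mul_assoc]

theorem IsCocycle.exists_le_fgNorm [Finite Ω] [Finite X] {N : F → ℕ} (hN : IsLength N)
    (hp : IsCocycle e p) : ∃ c, ∀ ω w, N (p ω w) ≤ c * fgNorm w := by
  obtain ⟨c, hc⟩ := (Set.finite_range fun q : Ω × X => N (p q.1 (FreeGroup.of q.2))).bddAbove
  have hc' : ∀ ω x, N (p ω (FreeGroup.of x)) ≤ c := fun ω x => hc ⟨(ω, x), rfl⟩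
  refine ⟨c, fun ω => fgNorm_induction (Q := fun w n => N (p ω w) ≤ c * n) ?_ ?_ ?_⟩
  · simp [hN.one, hp.one]
  · intro w n x h
    rw [hp, mul_add, mul_one]
    exact (hN.mul _ _).trans (add_le_add h (hc' _ x))
  · intro w n x h
    rw [hp, hp.inv, mul_add, mul_one]
    exact (hN.mul _ _).trans (add_le_add h ((hN.inv _).trans_le (hc' _ x)))

/-- Two cocycles over the same action that agree on letters modulo `ker ψ` agree on words up to
a filling of linear area. -/
theorem IsCocycle.exists_fill_compare [Finite Ω] [Finite X] {E : Type*} [Group E]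
    {p' : Ω → FreeGroup X → F} (hp : IsCocycle e p) (hp' : IsCocycle e p') (ψ : F →* E)
    (h : ∀ ω x, ψ (p ω (FreeGroup.of x)) = ψ (p' ω (FreeGroup.of x)))
    {N : E → ℕ} (hN : IsLength N) :
    ∃ R : Set F, R.Finite ∧ (∀ r ∈ R, ψ r = 1) ∧ ∃ c, ∀ ω w,
      Fill R {x | N (ψ x) ≤ c * fgNorm w} (fgNorm w) (p ω w * (p' ω w)⁻¹) := by
  obtain ⟨c, hc⟩ := hp.exists_le_fgNorm (N := fun x => N (ψ x)) (hN.comp ψ)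
  let r1 : Ω × X → F := fun q => p q.1 (FreeGroup.of q.2) * (p' q.1 (FreeGroup.of q.2))⁻¹
  let r2 : Ω × X → F := fun q => (p q.1 (FreeGroup.of q.2))⁻¹ * p' q.1 (FreeGroup.of q.2)
  refine ⟨Set.range r1 ∪ Set.range r2, (Set.finite_range _).union (Set.finite_range _), ?_, c, ?_⟩
  · rintro _ (⟨q, rfl⟩ | ⟨q, rfl⟩) <;> simp [r1, r2, h]
  intro ω w
  have key := fgNorm_induction
    (Q := fun w n => ∀ L, n ≤ L → N (ψ (p ω w)) ≤ c * n ∧ Fill (Set.range r1 ∪ Set.range r2)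
      {x | N (ψ x) ≤ c * L} n (p ω w * (p' ω w)⁻¹)) ?_ ?_ ?_ w
  · exact (key _ le_rfl).2
  · intro L _
    simpa [hp.one, hp'.one, hN.one] using Fill.one 0
  · intro w n x ih L hL
    have h1 : N (ψ (p ω w)) ≤ c * L := (ih L (by omega)).1.trans (by gcongr; omega)
    refine ⟨?_, ?_⟩
    · rw [hp, map_mul, mul_add]
      refine (hN.mul _ _).trans (add_le_add (ih L (by omega)).1 ?_)
      simpa [fgNorm_of] using hc ((e w)⁻¹ ω) (FreeGroup.of x)
    · have := Fill.cons (R := Set.range r1 ∪ Set.range r2) (S := {x | N (ψ x) ≤ c * L})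
        (Or.inl (Or.inl ⟨((e w)⁻¹ ω, x), rfl⟩)) h1 (ih L (by omega)).2
      rw [hp, hp']
      simpa [r1, mul_assoc] using this
  · intro w n x ih L hL
    have h1 : N (ψ (p ω w)) ≤ c * L := (ih L (by omega)).1.trans (by gcongr; omega)
    refine ⟨?_, ?_⟩
    · rw [hp, map_mul, mul_add]
      refine (hN.mul _ _).trans (add_le_add (ih L (by omega)).1 ?_)
      simpa [fgNorm_of, fgNorm_inv] using hc ((e w)⁻¹ ω) (FreeGroup.of x)⁻¹
    · have := Fill.cons (R := Set.range r1 ∪ Set.range r2) (S := {x | N (ψ x) ≤ c * L})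
        (Or.inl (Or.inr ⟨(e (FreeGroup.of x) ((e w)⁻¹ ω), x), rfl⟩)) h1 (ih L (by omega)).2
      rw [hp, hp', hp.inv, hp'.inv]
      simpa [r2, mul_assoc] using this

end Cocycle

section Filling

variable {X B Ω E : Type} [Group E] {N : E → ℕ} {A P : ℕ → ℕ}

/-- Null words over `φ` have fillings by finitely many relators whose area is controlled by `A`,
and such that the conjugating elements have `N`-length controlled by `P`. -/
def FillsWith (φ : FreeGroup X →* E) (N : E → ℕ) (A P : ℕ → ℕ) : Prop :=
  ∃ R : Set (FreeGroup X), R.Finite ∧ (∀ r ∈ R, φ r = 1) ∧ ∃ C, ∀ L w, φ w = 1 →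
    C * (fgNorm w + 1) ≤ L → Fill R {x | N (φ x) ≤ C * P L} (C * A L) w

/-- The subgroup `G` has a finite generating family whose null words satisfy `FillsWith`. -/
def HasFill (G : Subgroup E) (N : E → ℕ) (A P : ℕ → ℕ) : Prop :=
  ∃ (X : Type) (_ : Finite X) (φ : FreeGroup X →* E), φ.range = G ∧ FillsWith φ N A P

theorem FillsWith.push [Finite B] {φ : FreeGroup X →* E} {ψ : FreeGroup B →* E}
    (hN : IsLength N) (hφ : FillsWith φ N A P) (hP : ∀ L, L ≤ P L) (hA : ∀ L, L ≤ A L)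
    {e : FreeGroup X →* Equiv.Perm Ω} {p : Ω → FreeGroup X → FreeGroup B} (hp : IsCocycle e p)
    {τ : Ω → E} (hτ : ∀ ω x, ψ (p ω (FreeGroup.of x)) =
      τ ω * φ (FreeGroup.of x) * (τ ((e (FreeGroup.of x))⁻¹ ω))⁻¹)
    {ω₀ : Ω} (hω₀ : τ ω₀ = 1) (he : ∀ r, φ r = 1 → e r = 1)
    (hB : ∀ b, ∃ u, φ u = ψ (FreeGroup.of b) ∧ e u ω₀ = ω₀)
    {c₁ : ℕ} (hc₁ : ∀ x, N (τ ((e x)⁻¹ ω₀)) ≤ c₁ * (N (φ x) + 1)) (d : ℕ)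
    (hfill : ∀ r, φ r = 1 → ∃ R' : Set (FreeGroup B), R'.Finite ∧ (∀ r' ∈ R', ψ r' = 1) ∧
      ∃ c, ∀ n, 1 ≤ n → ∀ x, N (φ x) ≤ n →
        Fill R' {y | N (ψ y) ≤ c * n} (c * n ^ d) (p ((e x)⁻¹ ω₀) r)) :
    FillsWith ψ N (fun L => P L ^ d * A L) P := by
  obtain ⟨R, hRf, hR1, C, hC⟩ := hφ
  choose! R' hR'f hR'1 c hc using hfill
  have hc₂ : ∃ c₂, ∀ r ∈ R, c r ≤ c₂ := by
    obtain ⟨c₂, h⟩ := (hRf.image c).bddAbove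
    exact ⟨c₂, fun r hr => h ⟨r, hr, rfl⟩⟩
  obtain ⟨c₂, hc₂⟩ := hc₂
  choose β hβ hβe using hB
  let f : FreeGroup B →* FreeGroup X := FreeGroup.lift β
  have hf : ∀ w, φ (f w) = ψ w := by
    intro w
    have : φ.comp f = ψ := FreeGroup.ext_hom _ _ fun b => by simp [f, hβ]
    exact DFunLike.congr_fun this w
  have hfe : ∀ w, e (f w) ω₀ = ω₀ := by
    have hfb : ∀ b, f (FreeGroup.of b) = β b := fun b => by simp [f]
    intro w
    refine fgNorm_induction (Q := fun w _ => e (f w) ω₀ = ω₀) (by simp) ?_ ?_ w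
    · intro w n b ih
      rw [map_mul, map_mul, Equiv.Perm.mul_apply, hfb, hβe, ih]
    · intro w n b ih
      have h1 : (e (β b))⁻¹ ω₀ = ω₀ := by rw [Equiv.Perm.inv_eq_iff_eq, hβe]
      rw [map_mul, map_mul, Equiv.Perm.mul_apply, map_inv, map_inv, hfb, h1, ih]
  have hfe' : ∀ w, (e (f w))⁻¹ ω₀ = ω₀ := fun w => by rw [Equiv.Perm.inv_eq_iff_eq, hfe]
  obtain ⟨b, hb⟩ := isLength_fgNorm.exists_le_fgNorm f
  let e₀ : FreeGroup B →* Equiv.Perm Unit := 1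
  have hp1 : IsCocycle e₀ (fun _ w => w) := fun _ _ _ => rfl
  have hp2 : IsCocycle e₀ (fun _ w => p ω₀ (f w)) := fun _ u v => by
    simp only [map_mul]; rw [hp, hfe']
  have hψp : ∀ w, ψ (p ω₀ (f w)) = ψ w := fun w => by
    rw [hp.map_eq ψ φ τ hτ, hfe', hω₀, hf]; simp
  obtain ⟨R₃, hR₃f, hR₃1, c₃, h₃⟩ :=
    hp1.exists_fill_compare hp2 ψ (fun _ x => (hψp _).symm) hN
  refine ⟨(⋃ r ∈ R, R' r) ∪ R₃, (hRf.biUnion fun r hr => hR'f r (hR1 r hr)).union hR₃f, ?_,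
    C * (b + 1) + (1 + 2 * c₁ + c₂) * (C + 1) + c₃ + (C * c₂ * (C + 1) ^ d) + 1, ?_⟩
  · rintro r (hr | hr)
    · simp only [Set.mem_iUnion] at hr
      obtain ⟨s, hs, hr⟩ := hr
      exact hR'1 s (hR1 s hs) r hr
    · exact hR₃1 r hr
  intro L w hw hL
  have hL1 : fgNorm w + 1 ≤ L := le_trans (Nat.le_mul_of_pos_left _ (Nat.succ_pos _)) hL
  have hPL : 1 ≤ P L := le_trans (by omega) (hP L)
  have hbase := hC L (f w) (by rw [hf, hw]) (by
    have : C * (fgNorm (f w) + 1) ≤ C * (b + 1) * (fgNorm w + 1) := by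
      rw [mul_assoc]; gcongr; nlinarith [hb w]
    refine le_trans (this.trans ?_) hL
    gcongr; omega)
  set n := C * P L + 1 with hn
  have hnP : n ≤ (C + 1) * P L := by rw [hn]; nlinarith
  have hlift : Fill ((⋃ r ∈ R, R' r) ∪ R₃) {y | N (ψ y) ≤ (1 + 2 * c₁ + c₂) * n}
      (C * A L * (c₂ * n ^ d)) (p ω₀ (f w)) := by
    have hr1 : ∀ r, (r ∈ R ∨ r⁻¹ ∈ R) → φ r = 1 := by
      rintro r (hr | hr)
      · exact hR1 r hr
      · simpa using hR1 _ hr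
    refine Fill.bind (f := p ω₀) (hp.one _) ?_ ?_ hbase
    · intro x _ r hr v
      rw [hp ω₀ (x * r * x⁻¹)]
      simp [he r (hr1 r hr)]
    · intro x hx r hr
      have hxn : N (φ x) ≤ n := le_trans hx (by omega)
      have h1 : Fill ((⋃ r ∈ R, R' r) ∪ R₃) {y | N (ψ y) ≤ c₂ * n} (c₂ * n ^ d)
          (p ((e x)⁻¹ ω₀) r) := by
        have aux : ∀ s ∈ R, Fill ((⋃ r ∈ R, R' r) ∪ R₃) {y | N (ψ y) ≤ c₂ * n} (c₂ * n ^ d)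
            (p ((e x)⁻¹ ω₀) s) := fun s hs =>
          (hc s (hR1 s hs) n (by omega) x hxn).mono
            (fun y hy => Or.inl (Set.mem_biUnion hs hy))
            (fun y hy => le_trans hy (Nat.mul_le_mul_right _ (hc₂ s hs)))
            (Nat.mul_le_mul_right _ (hc₂ s hs))
        rcases hr with hr | hr
        · exact aux r hr
        · have h2 := (aux _ hr).inv
          rw [hp.inv, he r (hr1 r (Or.inr hr))] at h2
          simpa using h2
      rw [hp.conj _ _ (he r (hr1 r hr))]
      refine h1.conj fun y hy => ?_
      have hy' : N (ψ y) ≤ c₂ * n := hy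
      have hτx := hc₁ x
      have : N (ψ (p ω₀ x)) ≤ n + c₁ * (n + 1) := by
        rw [hp.map_eq ψ φ τ hτ, hω₀, one_mul]
        refine (hN.mul _ _).trans (add_le_add hxn ?_)
        rw [hN.inv]
        exact hτx.trans (by gcongr)
      show N (ψ (p ω₀ x * y)) ≤ _
      rw [map_mul]
      refine (hN.mul _ _).trans ((add_le_add this hy').trans ?_)
      have : c₁ * 1 ≤ c₁ * n := by gcongr; omega
      nlinarith
  have hcmp := h₃ () w
  have hfin := (hcmp.mono (S' := {y | N (ψ y) ≤ (C * (b + 1) + (1 + 2 * c₁ + c₂) * (C + 1) + c₃ +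
      (C * c₂ * (C + 1) ^ d) + 1) * P L}) (m := P L ^ d * A L) Set.subset_union_right
      (fun y hy => ?_) ?_).mul (hlift.mono subset_rfl (fun y hy => ?_) le_rfl)
  · rw [inv_mul_cancel_right] at hfin
    refine hfin.mono subset_rfl subset_rfl ?_
    have h1 : n ^ d ≤ (C + 1) ^ d * P L ^ d := by
      rw [← mul_pow]; exact Nat.pow_le_pow_left hnP d
    calc P L ^ d * A L + C * A L * (c₂ * n ^ d)
        ≤ P L ^ d * A L + C * A L * (c₂ * ((C + 1) ^ d * P L ^ d)) := by gcongr
      _ = (C * c₂ * (C + 1) ^ d + 1) * (P L ^ d * A L) := by ring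
      _ ≤ _ := by gcongr; omega
  · have hy' : N (ψ y) ≤ c₃ * fgNorm w := hy
    refine le_trans hy' (Nat.mul_le_mul (by omega) ?_)
    exact le_trans (by omega) (hP L)
  · refine le_trans (le_trans (by omega) (hA L)) (Nat.le_mul_of_pos_left _ (by positivity))
  · have hy' : N (ψ y) ≤ (1 + 2 * c₁ + c₂) * n := hy
    refine le_trans hy' ?_
    calc (1 + 2 * c₁ + c₂) * n ≤ (1 + 2 * c₁ + c₂) * ((C + 1) * P L) := by gcongr
      _ = ((1 + 2 * c₁ + c₂) * (C + 1)) * P L := by ring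
      _ ≤ _ := by gcongr; omega

theorem range_eq_of_cocycle {φ : FreeGroup X →* E} {ψ : FreeGroup B →* E} {K : Subgroup E}
    (hK : K ≤ φ.range) (hψ : ∀ b, ψ (FreeGroup.of b) ∈ K)
    {e : FreeGroup X →* Equiv.Perm Ω} {p : Ω → FreeGroup X → FreeGroup B} (hp : IsCocycle e p)
    {τ : Ω → E} (hτ : ∀ ω x, ψ (p ω (FreeGroup.of x)) =
      τ ω * φ (FreeGroup.of x) * (τ ((e (FreeGroup.of x))⁻¹ ω))⁻¹)
    {ω₀ : Ω} (hω₀ : τ ω₀ = 1) (heK : ∀ w, φ w ∈ K → e w ω₀ = ω₀) : ψ.range = K := by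
  refine le_antisymm ?_ fun g hg => ?_
  · rintro _ ⟨w, rfl⟩
    refine fgNorm_induction (Q := fun w _ => ψ w ∈ K) (by simp) ?_ ?_ w
    · intro w n b ih
      rw [map_mul]
      exact mul_mem ih (hψ b)
    · intro w n b ih
      rw [map_mul, map_inv]
      exact mul_mem ih (inv_mem (hψ b))
  · obtain ⟨w, rfl⟩ := hK hg
    refine ⟨p ω₀ w, ?_⟩
    rw [hp.map_eq ψ φ τ hτ, show (e w)⁻¹ ω₀ = ω₀ by rw [Equiv.Perm.inv_eq_iff_eq, heK w hg], hω₀]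
    simp

theorem exists_coset_action {φ : FreeGroup X →* E} (K : Subgroup E) [K.FiniteIndex] :
    ∃ (Ω : Type) (_ : Finite Ω) (e : FreeGroup X →* Equiv.Perm Ω) (τ : Ω → E) (ω₀ : Ω),
      τ ω₀ = 1 ∧ (∀ r, φ r = 1 → e r = 1) ∧ (∀ w, e w ω₀ = ω₀ ↔ φ w ∈ K) ∧
      ∀ ω w, τ ω * φ w * (τ ((e w)⁻¹ ω))⁻¹ ∈ K := by
  classical
  let s : E ⧸ K → E := fun ω => if ω = ((1 : E) : E ⧸ K) then 1 else ω.out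
  have hs : ∀ ω, (s ω : E ⧸ K) = ω := by
    intro ω
    by_cases h : ω = ((1 : E) : E ⧸ K) <;> simp [s, h]
  refine ⟨E ⧸ K, inferInstance, (MulAction.toPermHom E (E ⧸ K)).comp φ, fun ω => (s ω)⁻¹,
    ((1 : E) : E ⧸ K), by simp [s], fun r hr => by rw [MonoidHom.comp_apply, hr, map_one], fun w => ?_, fun ω w => ?_⟩
  · simp only [MonoidHom.comp_apply, MulAction.toPermHom_apply, MulAction.toPerm_apply]
    rw [MulAction.Quotient.smul_coe, eq_comm, QuotientGroup.eq]
    simp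
  · rw [inv_inv, mul_assoc, ← QuotientGroup.eq, hs, ← smul_eq_mul, ← MulAction.Quotient.smul_coe,
      hs, ← map_inv]
    change ω = φ w • φ w⁻¹ • ω
    rw [map_inv, smul_inv_smul]

end Filling

section FiniteIndex

variable {X E : Type} [Group E] {N : E → ℕ} {A P : ℕ → ℕ}

theorem HasFill.finiteIndex (hN : IsLength N) (hP : ∀ L, L ≤ P L) (hA : ∀ L, L ≤ A L)
    (h : HasFill (⊤ : Subgroup E) N A P) (K : Subgroup E) [K.FiniteIndex] : HasFill K N A P := by
  obtain ⟨X, _, φ, hφ, hfill⟩ := h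
  obtain ⟨Ω, _, e, τ, ω₀, hω₀, he, heK, hτ⟩ := exists_coset_action (φ := φ) K
  obtain ⟨p, hp, hpx⟩ := exists_cocycle e fun ω x => FreeGroup.of (ω, x)
  let ψ : FreeGroup (Ω × X) →* E := FreeGroup.lift fun b =>
    τ b.1 * φ (FreeGroup.of b.2) * (τ ((e (FreeGroup.of b.2))⁻¹ b.1))⁻¹
  have hψ : ∀ ω x, ψ (p ω (FreeGroup.of x)) =
      τ ω * φ (FreeGroup.of x) * (τ ((e (FreeGroup.of x))⁻¹ ω))⁻¹ := fun ω x => by simp [hpx, ψ]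
  have hψK : ∀ b, ψ (FreeGroup.of b) ∈ K := fun b => by simpa [ψ] using hτ b.1 (FreeGroup.of b.2)
  obtain ⟨c, hc⟩ := (Set.finite_range fun ω => N (τ ω)).bddAbove
  have hc' : ∀ ω, N (τ ω) ≤ c := fun ω => hc ⟨ω, rfl⟩
  refine ⟨Ω × X, inferInstance, ψ,
    range_eq_of_cocycle (hφ ▸ le_top) hψK hp hψ hω₀ fun w hw => (heK w).2 hw, ?_⟩
  have key := FillsWith.push (d := 0) (c₁ := c) hN hfill hP hA hp hψ hω₀ he ?_ ?_ ?_
  · simpa using key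
  · intro b
    obtain ⟨u, hu⟩ : ψ (FreeGroup.of b) ∈ φ.range := hφ ▸ mem_top _
    exact ⟨u, hu, (heK u).2 (hu ▸ hψK b)⟩
  · exact fun x => (hc' _).trans (Nat.le_mul_of_pos_right _ (Nat.succ_pos _))
  · intro r hr
    refine ⟨Set.range fun ω => p ω r, Set.finite_range _, ?_, 1, fun n _ x _ => ?_⟩
    · rintro _ ⟨ω, rfl⟩
      rw [hp.map_eq ψ φ τ hψ, he r hr, hr]
      simp
    · have := Fill.single (R := Set.range fun ω => p ω r) (S := {y | N (ψ y) ≤ 1 * n}) (x := 1)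
        (Or.inl ⟨(e x)⁻¹ ω₀, rfl⟩) (by
          show N (ψ 1) ≤ _
          rw [map_one, hN.one]
          exact Nat.zero_le _)
      simpa using this

/-- Homomorphisms to `ℤ` from a finite-index subgroup are Lipschitz for the ambient length. -/
theorem exists_natAbs_le [Finite X] {φ : FreeGroup X →* E}
    (hNφ : ∀ g, ∃ w, φ w = g ∧ fgNorm w ≤ N g) (K : Subgroup E) [K.FiniteIndex]
    (θ : K →* Multiplicative ℤ) : ∃ c, ∀ g : K, (θ g).toAdd.natAbs ≤ c * N g := by
  obtain ⟨Ω, _, e, τ, ω₀, hω₀, he, heK, hτ⟩ := exists_coset_action (φ := φ) K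
  obtain ⟨p, hp, hpx⟩ := exists_cocycle e fun ω x => (⟨_, hτ ω (FreeGroup.of x)⟩ : K)
  have hlen : IsLength fun g : K => (θ g).toAdd.natAbs :=
    ⟨by simp, fun g => by simp, fun g h => by simpa using Int.natAbs_add_le _ _⟩
  obtain ⟨c, hc⟩ := hp.exists_le_fgNorm hlen
  refine ⟨c, fun g => ?_⟩
  obtain ⟨w, hw, hwN⟩ := hNφ g
  have h1 := hp.map_eq K.subtype φ τ (fun ω x => by simp [hpx]) ω₀ w
  rw [show (e w)⁻¹ ω₀ = ω₀ by rw [Equiv.Perm.inv_eq_iff_eq, (heK w).2 (hw ▸ g.2)], hω₀, hw] at h1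
  have h2 : p ω₀ w = g := by
    apply Subtype.ext
    simpa using h1
  rw [← h2]
  exact (hc ω₀ w).trans (h2 ▸ Nat.mul_le_mul_left _ hwN)

end FiniteIndex

section Differences

variable {E W : Type*} [Group E] [Group W]

/-- A partial power system: a homomorphism `I` and a map `p` on `K`, where `p` is multiplicative on
commuting pairs and equivariant for conjugation through `I`. -/
structure PowerSystem (K : Subgroup E) (I p : E → W) : Prop where
  I_mul : ∀ u ∈ K, ∀ v ∈ K, I (u * v) = I u * I v
  conj : ∀ v ∈ K, ∀ u ∈ K, I v * p u = p (v * u * v⁻¹) * I v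
  mul_of_commute : ∀ u ∈ K, ∀ v ∈ K, Commute u v → p (u * v) = p u * p v

variable {K : Subgroup E} {I p : E → W}

theorem PowerSystem.one (S : PowerSystem K I p) : p 1 = 1 := by
  simpa using S.mul_of_commute 1 K.one_mem 1 K.one_mem (Commute.refl _)

theorem PowerSystem.mul_inv (S : PowerSystem K I p) {u : E} (hu : u ∈ K) : p u * p u⁻¹ = 1 := by
  rw [← S.mul_of_commute u hu _ (inv_mem hu) (Commute.refl u).inv_right, mul_inv_cancel, S.one]

theorem PowerSystem.I_one (S : PowerSystem K I p) : I 1 = 1 := by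
  simpa using S.I_mul 1 K.one_mem 1 K.one_mem

theorem PowerSystem.mul_div (S : PowerSystem K I p) {a b f : E} (haf : a * f⁻¹ ∈ K)
    (hfb : f * b⁻¹ ∈ K) (h1 : Commute a b) (h2 : Commute a f) (h3 : Commute b f) :
    p (a * f⁻¹) * p (f * b⁻¹) = p (a * b⁻¹) := by
  rw [← S.mul_of_commute _ haf _ hfb]
  · simp [mul_assoc]
  · exact (h2.mul_right h1.inv_right).mul_left
      ((Commute.refl f).inv_left.mul_right h3.symm.inv_inv)

theorem PowerSystem.div_mul_div_mul_div (S : PowerSystem K I p) {a d b b' f : E}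
    (haf : a * f⁻¹ ∈ K) (hbf : b * f⁻¹ ∈ K) (hbf' : b' * f⁻¹ ∈ K) (hdf : d * f⁻¹ ∈ K)
    (hab : Commute a b) (hab' : Commute a b') (hdb : Commute d b) (hdb' : Commute d b')
    (ha : Commute a f) (hb : Commute b f) (hb' : Commute b' f) (hd : Commute d f) :
    p (b * a⁻¹) * p (a * b'⁻¹) * p (b' * d⁻¹) = p (b * d⁻¹) := by
  have inv : ∀ {x : E}, x * f⁻¹ ∈ K → f * x⁻¹ ∈ K := fun hx => by simpa using inv_mem hx
  have cancel : ∀ {x : E}, x * f⁻¹ ∈ K → p (f * x⁻¹) * p (x * f⁻¹) = 1 := fun {x} hx => by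
    simpa using S.mul_inv (inv hx)
  rw [← S.mul_div hbf (inv haf) hab.symm hb ha, ← S.mul_div haf (inv hbf') hab' ha hb',
    ← S.mul_div hbf' (inv hdf) hdb'.symm hb' hd, ← S.mul_div hbf (inv hdf) hdb.symm hb hd]
  calc _ = p (b * f⁻¹) * (p (f * a⁻¹) * p (a * f⁻¹)) * (p (f * b'⁻¹) * p (b' * f⁻¹)) *
        p (f * d⁻¹) := by simp only [mul_assoc]
    _ = _ := by rw [cancel haf, cancel hbf']; simp

variable {h : E →* Multiplicative ℤ} {t₁ t₂ t₃ : E}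

theorem conj_zpow_mul (h12 : ∀ g g', Commute (g * t₁ * g⁻¹) (g' * t₂ * g'⁻¹)) (x : E) (k : ℤ) :
    (t₁ * t₂⁻¹) ^ k * (t₂ * (x * t₁⁻¹ * x⁻¹)) ^ k = t₁ ^ k * x * (t₁ ^ k)⁻¹ * x⁻¹ := by
  have h1 : Commute t₁ t₂⁻¹ := by simpa using (h12 1 1).inv_right
  have h2 : Commute t₂ (x * t₁⁻¹ * x⁻¹) := by
    have := (h12 x 1).symm.inv_right
    simpa [mul_assoc] using this
  rw [h1.mul_zpow, h2.mul_zpow, conj_zpow, inv_zpow, inv_zpow]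
  simp [mul_assoc]

/-- The normal form `p (t₁ t₂⁻¹) p (t₂ t₁⁻ᵍ) I (g t₁⁻ʰ⁽ᵍ⁾)`, where `t₁⁻ᵍ` is a conjugate. -/
def normalForm (h : E →* Multiplicative ℤ) (t₁ t₂ : E) (I p : E → W) (g : E) : W :=
  p (t₁ * t₂⁻¹) * p (t₂ * (g * t₁⁻¹ * g⁻¹)) * I (g * t₁ ^ (-(h g).toAdd))

theorem PowerSystem.normalForm_mul (S : PowerSystem K I p) {G : Subgroup E}
    (hK : K = G ⊓ h.ker) (ht₁ : t₁ ∈ G) (ht₂ : t₂ ∈ G) (ht₃ : t₃ ∈ G)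
    (hh₁ : h t₁ = .ofAdd 1) (hh₂ : h t₂ = .ofAdd 1) (hh₃ : h t₃ = .ofAdd 1)
    (h12 : ∀ g g', Commute (g * t₁ * g⁻¹) (g' * t₂ * g'⁻¹))
    (h13 : ∀ g g', Commute (g * t₁ * g⁻¹) (g' * t₃ * g'⁻¹))
    (h23 : ∀ g g', Commute (g * t₂ * g⁻¹) (g' * t₃ * g'⁻¹)) {g x : E} (hg : g ∈ G) (hx : x ∈ G) :
    normalForm h t₁ t₂ I p g * (p (t₁ * t₂⁻¹) * I ((t₁ * t₂⁻¹) ^ (h g).toAdd) *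
      (p (t₂ * (x * t₁⁻¹ * x⁻¹)) * I ((t₂ * (x * t₁⁻¹ * x⁻¹)) ^ (h g).toAdd)) *
      I (x * t₁ ^ (-(h x).toAdd))) = normalForm h t₁ t₂ I p (g * x) := by
  have mem : ∀ a, a ∈ K ↔ a ∈ G ∧ h a = 1 := fun a => by rw [hK]; rfl
  have hκ : ∀ y ∈ G, y * t₁ ^ (-(h y).toAdd) ∈ K := fun y hy => by
    refine (mem _).2 ⟨mul_mem hy (zpow_mem ht₁ _), ?_⟩
    rw [map_mul, map_zpow, hh₁, ← ofAdd_zsmul]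
    simp
  have div : ∀ a b, a ∈ G → b ∈ G → h a = .ofAdd 1 → h b = .ofAdd 1 → a * b⁻¹ ∈ K :=
    fun a b ha hb ha1 hb1 => (mem _).2 ⟨mul_mem ha (inv_mem hb), by simp [ha1, hb1]⟩
  set m := (h g).toAdd with hm
  set κ := g * t₁ ^ (-m) with hκdef
  have hκG : κ ∈ G := ((mem _).1 (hκ g hg)).1
  have hcK : t₁ * t₂⁻¹ ∈ K := div _ _ ht₁ ht₂ hh₁ hh₂
  have hzx : t₂ * (x * t₁⁻¹ * x⁻¹) ∈ K := by
    have := div t₂ (x * t₁ * x⁻¹) ht₂ (mul_mem (mul_mem hx ht₁) (inv_mem hx)) hh₂ (by simp [hh₁])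
    simpa [mul_assoc] using this
  set c := t₁ * t₂⁻¹ with hc
  set z := t₂ * (x * t₁⁻¹ * x⁻¹) with hz
  have hcz : c ^ m * z ^ m = t₁ ^ m * x * (t₁ ^ m)⁻¹ * x⁻¹ := conj_zpow_mul h12 x m
  have e1 : I κ * p c = p (κ * c * κ⁻¹) * I κ := S.conj _ (hκ g hg) _ hcK
  have e2 : I (κ * c ^ m) * p z = p ((κ * c ^ m) * z * (κ * c ^ m)⁻¹) * I (κ * c ^ m) :=
    S.conj _ (mul_mem (hκ g hg) (zpow_mem hcK _)) _ hzx
  have e3 : κ * c * κ⁻¹ = g * t₁ * g⁻¹ * (κ * t₂ * κ⁻¹)⁻¹ := by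
    rw [hc, hκdef]
    group
  have h2s : Commute t₂ (t₁ ^ m * x * (t₁ ^ m)⁻¹ * x⁻¹) := by
    have a1 : Commute t₁ t₂ := by simpa using h12 1 1
    have a2 : Commute (x * t₁ * x⁻¹) t₂ := by simpa using h12 x 1
    have := (a1.zpow_left m).mul_left (a2.zpow_left m).inv_left
    rw [conj_zpow] at this
    simpa [mul_assoc] using this.symm
  have e4 : (κ * c ^ m) * z * (κ * c ^ m)⁻¹ = κ * t₂ * κ⁻¹ * (g * x * t₁ * (g * x)⁻¹)⁻¹ := by
    have s1 : (κ * c ^ m) * z * (κ * c ^ m)⁻¹ =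
        κ * (c ^ m * z ^ m) * z * (κ * (c ^ m * z ^ m))⁻¹ := by group
    have s2 : κ * t₂ * κ⁻¹ = κ * (t₁ ^ m * x * (t₁ ^ m)⁻¹ * x⁻¹) * t₂ *
        (κ * (t₁ ^ m * x * (t₁ ^ m)⁻¹ * x⁻¹))⁻¹ := by
      rw [mul_assoc κ _ t₂, ← h2s.eq]
      group
    rw [s1, s2, hcz, hz, hκdef]
    group
  have e5 : κ * c ^ m * z ^ m * (x * t₁ ^ (-(h x).toAdd)) =
      g * x * t₁ ^ (-(h (g * x)).toAdd) := by
    rw [mul_assoc κ, hcz, hκdef, map_mul, toAdd_mul, ← hm]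
    group
  have cj : ∀ y ∈ G, ∀ t ∈ G, y * t * y⁻¹ ∈ G := fun y hy t ht => mul_mem (mul_mem hy ht) (inv_mem hy)
  have key := S.div_mul_div_mul_div (a := g * t₁ * g⁻¹) (d := g * x * t₁ * (g * x)⁻¹) (b := t₂)
    (b' := κ * t₂ * κ⁻¹) (f := t₃)
    (div _ _ (cj _ hg _ ht₁) ht₃ (by simp [hh₁]) hh₃) (div _ _ ht₂ ht₃ hh₂ hh₃)
    (div _ _ (cj _ hκG _ ht₂) ht₃ (by simp [hh₂]) hh₃)
    (div _ _ (cj _ (mul_mem hg hx) _ ht₁) ht₃ (by rw [map_mul, map_mul, map_inv, mul_inv_cancel_comm, hh₁]) hh₃)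
    (by simpa using h12 g 1) (h12 _ _) (by simpa using h12 (g * x) 1) (h12 _ _)
    (by simpa using h13 g 1) (by simpa using h23 1 1) (by simpa using h23 κ 1)
    (by simpa using h13 (g * x) 1)
  have z1 : t₂ * (g * t₁⁻¹ * g⁻¹) = t₂ * (g * t₁ * g⁻¹)⁻¹ := by group
  have z2 : t₂ * (g * x * t₁⁻¹ * (g * x)⁻¹) = t₂ * (g * x * t₁ * (g * x)⁻¹)⁻¹ := by group
  unfold normalForm
  rw [z1, z2, ← hm, ← hκdef, ← hc, ← key, ← e3, ← e4, ← e5]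
  have hcm := zpow_mem hcK m
  have hzm := zpow_mem hzx m
  rw [S.I_mul (κ * c ^ m * z ^ m) (mul_mem (mul_mem (hκ g hg) hcm) hzm) _ (hκ x hx),
    S.I_mul (κ * c ^ m) (mul_mem (hκ g hg) hcm) _ hzm]
  have e6 : I (κ * c ^ m) = I κ * I (c ^ m) := S.I_mul _ (hκ g hg) _ hcm
  calc _ = p c * p (t₂ * (g * t₁ * g⁻¹)⁻¹) * (I κ * p c) * I (c ^ m) * p z * I (z ^ m) *
        I (x * t₁ ^ (-(h x).toAdd)) := by simp only [mul_assoc]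
    _ = p c * p (t₂ * (g * t₁ * g⁻¹)⁻¹) * p (κ * c * κ⁻¹) * (I (κ * c ^ m) * p z) * I (z ^ m) *
        I (x * t₁ ^ (-(h x).toAdd)) := by rw [e1, e6]; simp only [← mul_assoc]
    _ = _ := by rw [e2]; simp only [mul_assoc]

theorem PowerSystem.normalForm_one (S : PowerSystem K I p)
    (hK : t₁ * t₂⁻¹ ∈ K) : normalForm h t₁ t₂ I p 1 = 1 := by
  have : t₂ * t₁⁻¹ = (t₁ * t₂⁻¹)⁻¹ := by group
  rw [normalForm, one_mul, inv_one, mul_one, this, S.mul_inv hK]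
  simp [S.I_one]

end Differences

section Sequences

variable {F E : Type} [Group F] [Group E] {N : E → ℕ}

theorem Fill.of_rec {R : Set F} {ψ : F →* E} (hN : IsLength N) {a s : ℤ → F} {x : F}
    (h0 : a 0 = 1) (hrec : ∀ k, a (k + 1) = s k * (x * a k * x⁻¹)) {M c m : ℕ}
    (hs : ∀ k : ℤ, k.natAbs ≤ M → Fill R {y | N (ψ y) ≤ c} m (s k)) (k : ℤ) (hk : k.natAbs ≤ M) :
    Fill R {y | N (ψ y) ≤ c + k.natAbs * N (ψ x)} (k.natAbs * m) (a k) := by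
  have conj : ∀ {j n : ℕ} {u y : F}, N (ψ y) = N (ψ x) →
      Fill R {z | N (ψ z) ≤ c + j * N (ψ x)} n u →
      Fill R {z | N (ψ z) ≤ c + (j + 1) * N (ψ x)} n (y * u * y⁻¹) := by
    intro j n u y hy h
    refine h.conj fun z hz => ?_
    have hz' : N (ψ z) ≤ c + j * N (ψ x) := hz
    show N (ψ (y * z)) ≤ _
    rw [map_mul, add_mul, one_mul]
    exact (hN.mul _ _).trans (by omega)
  have lift : ∀ {j n : ℕ} {u : F}, Fill R {z | N (ψ z) ≤ c} n u →
      Fill R {z | N (ψ z) ≤ c + j * N (ψ x)} n u := fun h =>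
    h.mono subset_rfl (fun z hz => le_trans hz (Nat.le_add_right _ _)) le_rfl
  have key : ∀ j : ℕ, j ≤ M → Fill R {y | N (ψ y) ≤ c + j * N (ψ x)} (j * m) (a j) ∧
      Fill R {y | N (ψ y) ≤ c + j * N (ψ x)} (j * m) (a (-j)) := by
    intro j
    induction j with
    | zero => intro _; simpa [h0] using Fill.one 0
    | succ j ih =>
      intro hj
      obtain ⟨ih1, ih2⟩ := ih (by omega)
      constructor
      · have := (lift (hs j (by omega))).mul (conj rfl ih1)
        rw [← hrec] at this
        rw [Nat.succ_mul j m, add_comm (j * m)]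
        exact_mod_cast this
      · have h1 : a (-((j + 1 : ℕ) : ℤ)) =
            x⁻¹ * ((s (-((j + 1 : ℕ) : ℤ)))⁻¹ * a (-j)) * x⁻¹⁻¹ := by
          have := hrec (-((j + 1 : ℕ) : ℤ))
          rw [show (-((j + 1 : ℕ) : ℤ)) + 1 = -j by push_cast; ring] at this
          rw [this]
          group
        rw [h1, Nat.succ_mul j m, add_comm (j * m)]
        refine conj (by rw [map_inv, hN.inv]) ((lift (hs _ (by omega)).inv).mul ih2)
  rcases Int.natAbs_eq k with h | h
  · rw [h, Int.natAbs_natCast]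
    exact (key _ hk).1
  · rw [h, Int.natAbs_neg, Int.natAbs_natCast]
    exact (key _ hk).2

theorem Fill.zpow_of_mem {R : Set F} {ψ : F →* E} (hN : IsLength N) {r : F} (hr : r ∈ R) (k : ℤ) :
    Fill R {y | N (ψ y) ≤ 0} k.natAbs (r ^ k) := by
  have := Fill.of_rec (R := R) (ψ := ψ) hN (a := fun k => r ^ k) (s := fun _ => r) (x := 1)
    (M := k.natAbs) (c := 0) (m := 1) (zpow_zero r) (fun k => by simp [zpow_add, add_comm k])
    (fun _ _ => by
      simpa [hN.one] using Fill.single (R := R) (S := {y | N (ψ y) ≤ 0}) (x := 1) (Or.inl hr)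
        (by simp [hN.one])) k le_rfl
  simpa [hN.one] using this

/-- If `u` and `v` commute modulo the relators, then `(u * v) ^ k` and `u ^ k * v ^ k` agree modulo
quadratically many relators. -/
theorem Fill.mul_zpow {R : Set F} {ψ : F →* E} (hN : IsLength N) {u v : F}
    (h : u * v * u⁻¹ * v⁻¹ ∈ R) (k : ℤ) :
    Fill R {y | N (ψ y) ≤ (k.natAbs + 1) * N (ψ u) + k.natAbs * N (ψ (u * v))}
      (k.natAbs * k.natAbs) (u ^ k * v ^ k * ((u * v) ^ k)⁻¹) := by
  set M := k.natAbs with hM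
  have h1 : ∀ j : ℤ, j.natAbs ≤ M →
      Fill R {y | N (ψ y) ≤ M * N (ψ u)} j.natAbs (u ^ j * v * (u ^ j)⁻¹ * v⁻¹) := by
    intro j hj
    have := Fill.of_rec (R := R) (ψ := ψ) hN (a := fun j => u ^ j * v * (u ^ j)⁻¹ * v⁻¹)
      (s := fun j => u ^ j * (u * v * u⁻¹ * v⁻¹) * (u ^ j)⁻¹) (x := 1) (M := M)
      (c := M * N (ψ u)) (m := 1) (by simp) (fun k => by group)
      (fun i hi => .single (Or.inl h) (by
        show N (ψ (u ^ i)) ≤ _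
        rw [map_zpow]
        exact (hN.zpow _ _).trans (Nat.mul_le_mul_right _ hi))) j hj
    simpa [hN.one] using this
  have := Fill.of_rec (R := R) (ψ := ψ) hN (a := fun j => u ^ j * v ^ j * ((u * v) ^ j)⁻¹)
    (s := fun j => u * (u ^ j * v * (u ^ j)⁻¹ * v⁻¹) * u⁻¹) (x := u * v) (M := M)
    (c := (M + 1) * N (ψ u)) (m := M) (by simp) (fun k => by
      rw [add_comm k 1]
      simp only [zpow_one_add, mul_inv_rev, mul_assoc, inv_mul_cancel_left])
    (fun i hi => ?_) k le_rfl
  · exact this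
  · refine ((h1 i hi).conj (y := u) fun y hy => ?_).mono subset_rfl subset_rfl hi
    have hy' : N (ψ y) ≤ M * N (ψ u) := hy
    show N (ψ (u * y)) ≤ _
    rw [map_mul, add_mul, one_mul]
    exact (hN.mul _ _).trans (by omega)

/-- Sequences whose image in `E` has linearly growing length. -/
def slowSeq (ψ : F →* E) (hN : IsLength N) : Subgroup (ℤ → F) where
  carrier := {u | ∃ c, ∀ k : ℤ, N (ψ (u k)) ≤ c * (k.natAbs + 1)}
  one_mem' := ⟨0, fun k => by simp [hN.one]⟩
  mul_mem' := by
    rintro u v ⟨c, hc⟩ ⟨d, hd⟩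
    refine ⟨c + d, fun k => ?_⟩
    rw [Pi.mul_apply, map_mul, add_mul]
    exact (hN.mul _ _).trans (add_le_add (hc k) (hd k))
  inv_mem' := by
    rintro u ⟨c, hc⟩
    exact ⟨c, fun k => by simpa [hN.inv] using hc k⟩

/-- Sequences of words that are null over finitely many relators, with quadratic area and
conjugating elements of linear length. -/
def nullSeq (ψ : F →* E) (hN : IsLength N) : Subgroup (slowSeq ψ hN) where
  carrier := {u | ∃ R : Set F, R.Finite ∧ (∀ r ∈ R, ψ r = 1) ∧ ∃ c, ∀ k : ℤ,
    Fill R {y | N (ψ y) ≤ c * (k.natAbs + 1)} (c * (k.natAbs + 1) ^ 2) (u.1 k)}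
  one_mem' := ⟨∅, Set.finite_empty, by simp, 0, fun k => .one _⟩
  mul_mem' := by
    rintro u v ⟨R, hR, hR1, c, hc⟩ ⟨R', hR', hR1', c', hc'⟩
    refine ⟨R ∪ R', hR.union hR', fun r hr => hr.elim (hR1 r) (hR1' r), c + c', fun k => ?_⟩
    rw [add_mul, add_mul]
    exact ((hc k).mono Set.subset_union_left (fun y hy => le_trans hy (Nat.le_add_right _ _))
      le_rfl).mul ((hc' k).mono Set.subset_union_right
        (fun y hy => le_trans hy (Nat.le_add_left _ _)) le_rfl)
  inv_mem' := by
    rintro u ⟨R, hR, hR1, c, hc⟩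
    exact ⟨R, hR, hR1, c, fun k => (hc k).inv⟩

instance nullSeq_normal (ψ : F →* E) (hN : IsLength N) : (nullSeq ψ hN).Normal := by
  constructor
  rintro u ⟨R, hR, hR1, c, hc⟩ ⟨v, d, hd⟩
  refine ⟨R, hR, hR1, c + d, fun k => ?_⟩
  refine ((hc k).conj (y := v k) fun y hy => ?_).mono subset_rfl subset_rfl
    (Nat.mul_le_mul_right _ (Nat.le_add_right c d))
  have hy' : N (ψ y) ≤ c * (k.natAbs + 1) := hy
  show N (ψ (v k * y)) ≤ _
  rw [map_mul]
  have := hd k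
  exact (hN.mul _ _).trans (by rw [add_mul]; omega)

/-- The constant sequence. -/
def constSeq (ψ : F →* E) (hN : IsLength N) : F →* slowSeq ψ hN :=
  (Pi.constMonoidHom ℤ F).codRestrict _ fun u => ⟨N (ψ u), fun k => by
    simp only [Pi.constMonoidHom_apply]
    exact Nat.le_mul_of_pos_right _ (Nat.succ_pos _)⟩

/-- The sequence of powers. -/
def powSeq (ψ : F →* E) (hN : IsLength N) (u : F) : slowSeq ψ hN :=
  ⟨fun k => u ^ k, N (ψ u), fun k => by
    rw [map_zpow, mul_comm]
    exact (hN.zpow _ _).trans (Nat.mul_le_mul_right _ (Nat.le_succ _))⟩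

theorem constSeq_mem_nullSeq {ψ : F →* E} (hN : IsLength N) {r : F} (hr : ψ r = 1) :
    constSeq ψ hN r ∈ nullSeq ψ hN := by
  refine ⟨{r}, Set.finite_singleton r, by simpa using hr, 1, fun k => ?_⟩
  have : Fill {r} {y | N (ψ y) ≤ 1 * (k.natAbs + 1)} 1 (1 * r * 1⁻¹) :=
    .single (Or.inl rfl) (by simp [hN.one])
  exact (by simpa using this : Fill _ _ _ r).mono subset_rfl subset_rfl
    (by rw [one_mul]; exact Nat.one_le_pow _ _ (Nat.succ_pos _))

theorem powSeq_mem_nullSeq {ψ : F →* E} (hN : IsLength N) {r : F} (hr : ψ r = 1) :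
    powSeq ψ hN r ∈ nullSeq ψ hN := by
  refine ⟨{r}, Set.finite_singleton r, by simpa using hr, 1, fun k => ?_⟩
  exact (Fill.zpow_of_mem hN (Set.mem_singleton r) k).mono subset_rfl (fun y hy => le_trans hy (Nat.zero_le _))
    (by nlinarith)

theorem powSeq_mul {ψ : F →* E} (hN : IsLength N) {u v : F} (h : Commute (ψ u) (ψ v)) :
    powSeq ψ hN u * powSeq ψ hN v * (powSeq ψ hN (u * v))⁻¹ ∈ nullSeq ψ hN := by
  refine ⟨{u * v * u⁻¹ * v⁻¹}, Set.finite_singleton _, ?_,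
    N (ψ u) + N (ψ (u * v)) + 1, fun k => ?_⟩
  · rintro _ rfl
    simp [h.eq]
  · refine (Fill.mul_zpow (ψ := ψ) hN (Set.mem_singleton _) k).mono subset_rfl
      (fun y hy => ?_) (le_trans ?_ (Nat.mul_le_mul_right _ (Nat.le_add_left 1 _)))
    · have hy' : N (ψ y) ≤ (k.natAbs + 1) * N (ψ u) + k.natAbs * N (ψ (u * v)) := hy
      show N (ψ y) ≤ _
      generalize k.natAbs = a at hy'
      nlinarith
    · generalize k.natAbs = a
      nlinarith

theorem exists_powerSystem (ψ : F →* E) (hN : IsLength N) :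
    ∃ I p : E → slowSeq ψ hN ⧸ nullSeq ψ hN, PowerSystem ψ.range I p ∧
      (∀ u, (constSeq ψ hN u : slowSeq ψ hN ⧸ nullSeq ψ hN) = I (ψ u)) ∧
      ∀ u, (powSeq ψ hN u : slowSeq ψ hN ⧸ nullSeq ψ hN) = p (ψ u) := by
  have s : ∀ g : E, ∃ u : F, g ∈ ψ.range → ψ u = g := fun g => by
    by_cases h : g ∈ ψ.range
    · obtain ⟨u, hu⟩ := h
      exact ⟨u, fun _ => hu⟩
    · exact ⟨1, fun h' => absurd h' h⟩
  choose s hs using s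
  have hs' : ∀ u, ψ (s (ψ u)) = ψ u := fun u => hs _ ⟨u, rfl⟩
  let i : F →* slowSeq ψ hN ⧸ nullSeq ψ hN := (QuotientGroup.mk' _).comp (constSeq ψ hN)
  let p : F → slowSeq ψ hN ⧸ nullSeq ψ hN := fun u => QuotientGroup.mk (powSeq ψ hN u)
  have hi : ∀ u v, ψ u = ψ v → i u = i v := fun u v h => by
    rw [← inv_mul_eq_one, ← map_inv, ← map_mul]
    exact (QuotientGroup.eq_one_iff _).2 (constSeq_mem_nullSeq hN (by simp [h]))
  have hpmul : ∀ u v, Commute (ψ u) (ψ v) → p (u * v) = p u * p v := fun u v h => by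
    have := (QuotientGroup.eq_one_iff _).2 (powSeq_mul hN h)
    rw [QuotientGroup.mk_mul, QuotientGroup.mk_mul, QuotientGroup.mk_inv, mul_inv_eq_one] at this
    exact this.symm
  have hp : ∀ u v, ψ u = ψ v → p u = p v := fun u v h => by
    have h1 : ψ (u⁻¹ * v) = 1 := by simp [h]
    have h2 : p (u⁻¹ * v) = 1 := (QuotientGroup.eq_one_iff _).2 (powSeq_mem_nullSeq hN h1)
    have h3 := hpmul u (u⁻¹ * v) (h1 ▸ Commute.one_right _)
    rw [h2, mul_one, mul_inv_cancel_left] at h3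
    exact h3.symm
  refine ⟨fun g => i (s g), fun g => p (s g), ⟨?_, ?_, ?_⟩, fun u => hi _ _ (hs' u).symm,
    fun u => hp _ _ (hs' u).symm⟩
  · rintro _ ⟨u, rfl⟩ _ ⟨v, rfl⟩
    have h1 : i (s (ψ u * ψ v)) = i (s (ψ u) * s (ψ v)) :=
      hi _ _ (by rw [← map_mul, hs']; simp [hs'])
    simp only [h1, map_mul]
  · rintro _ ⟨v, rfl⟩ _ ⟨u, rfl⟩
    have h1 : p (s (ψ v * ψ u * (ψ v)⁻¹)) = p (s (ψ v) * s (ψ u) * (s (ψ v))⁻¹) :=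
      hp _ _ (by rw [← map_inv, ← map_mul, ← map_mul, hs']; simp [hs'])
    simp only [h1]
    rw [← mul_inv_eq_iff_eq_mul]
    refine congrArg QuotientGroup.mk (Subtype.ext (funext fun k => ?_))
    exact (conj_zpow ..).symm
  · rintro _ ⟨u, rfl⟩ _ ⟨v, rfl⟩ h
    have h1 : p (s (ψ u * ψ v)) = p (s (ψ u) * s (ψ v)) :=
      hp _ _ (by rw [← map_mul, hs']; simp [hs'])
    simp only [h1]
    exact hpmul _ _ (by rwa [hs', hs'])

end Sequences

section Kernel

variable {E : Type} [Group E] {N : E → ℕ} {A P : ℕ → ℕ}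

/-- The action of a group on `ℤ` by translations, through a homomorphism. -/
def translation {X : Type} (f : FreeGroup X →* Multiplicative ℤ) : FreeGroup X →* Equiv.Perm ℤ where
  toFun w := Equiv.addRight (-(f w).toAdd)
  map_one' := by ext; simp
  map_mul' u v := by ext; simp

theorem translation_inv_apply {X : Type} (f : FreeGroup X →* Multiplicative ℤ) (w : FreeGroup X)
    (k : ℤ) : (translation f w)⁻¹ k = k + (f w).toAdd := by
  rw [Equiv.Perm.inv_eq_iff_eq]
  simp [translation]

theorem HasFill.inf_ker (hN : IsLength N) (hP : ∀ L, L ≤ P L) (hA : ∀ L, L ≤ A L)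
    {G : Subgroup E} (hG : HasFill G N A P) {h : E →* Multiplicative ℤ} {d : ℕ}
    (hd : ∀ g ∈ G, (h g).toAdd.natAbs ≤ d * N g) {t₁ t₂ t₃ : E}
    (ht₁ : t₁ ∈ G) (ht₂ : t₂ ∈ G) (ht₃ : t₃ ∈ G)
    (hh₁ : h t₁ = .ofAdd 1) (hh₂ : h t₂ = .ofAdd 1) (hh₃ : h t₃ = .ofAdd 1)
    (h12 : ∀ g g', Commute (g * t₁ * g⁻¹) (g' * t₂ * g'⁻¹))
    (h13 : ∀ g g', Commute (g * t₁ * g⁻¹) (g' * t₃ * g'⁻¹))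
    (h23 : ∀ g g', Commute (g * t₂ * g⁻¹) (g' * t₃ * g'⁻¹)) :
    HasFill (G ⊓ h.ker) N (fun L => P L ^ 2 * A L) P := by
  obtain ⟨X, _, φ, hφ, hfill⟩ := hG
  have hφG : ∀ w, φ w ∈ G := fun w => hφ ▸ ⟨w, rfl⟩
  have mem : ∀ a, a ∈ G ⊓ h.ker ↔ a ∈ G ∧ h a = 1 := fun a => Iff.rfl
  let b : Option (X ⊕ X) → E := fun b => b.elim (t₁ * t₂⁻¹)
    (Sum.elim (fun x => t₂ * (φ (.of x) * t₁⁻¹ * (φ (.of x))⁻¹))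
      fun x => φ (.of x) * t₁ ^ (-(h (φ (.of x))).toAdd))
  have hb : ∀ i, b i ∈ G ⊓ h.ker := by
    rintro (_ | x | x) <;> refine (mem _).2 ⟨?_, ?_⟩
    · exact mul_mem ht₁ (inv_mem ht₂)
    · simp [b, hh₁, hh₂]
    · exact mul_mem ht₂ (mul_mem (mul_mem (hφG _) (inv_mem ht₁)) (inv_mem (hφG _)))
    · simp [b, hh₁, hh₂]
    · exact mul_mem (hφG _) (zpow_mem ht₁ _)
    · simp only [b, Option.elim_some, Sum.elim_inr]
      rw [map_mul, map_zpow, hh₁, ← ofAdd_zsmul]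
      simp
  let ψ : FreeGroup (Option (X ⊕ X)) →* E := FreeGroup.lift b
  have hψ : ∀ i, ψ (.of i) = b i := fun i => FreeGroup.lift_apply_of
  let c : FreeGroup (Option (X ⊕ X)) := .of none
  let z : X → FreeGroup (Option (X ⊕ X)) := fun x => .of (some (.inl x))
  let κ : X → FreeGroup (Option (X ⊕ X)) := fun x => .of (some (.inr x))
  let e := translation (h.comp φ)
  have he : ∀ w k, (e w)⁻¹ k = k + (h (φ w)).toAdd := translation_inv_apply _
  obtain ⟨p, hp, hpx⟩ := exists_cocycle e fun k x => c ^ k * z x ^ k * κ x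
  have hτ : ∀ (k : ℤ) x, ψ (p k (.of x)) =
      t₁ ^ k * φ (.of x) * (t₁ ^ ((e (.of x))⁻¹ k))⁻¹ := by
    intro k x
    rw [hpx, he, map_mul, map_mul, map_zpow, map_zpow, hψ, hψ, hψ]
    simp only [b, Option.elim_none, Option.elim_some, Sum.elim_inl, Sum.elim_inr]
    rw [conj_zpow_mul h12, zpow_neg, zpow_add]
    simp only [mul_assoc, mul_inv_rev, inv_mul_cancel_left]
    rw [← mul_inv_rev, ← mul_inv_rev, ← zpow_add, ← zpow_add, add_comm]
  have hτ' := hp.map_eq ψ φ (fun k : ℤ => t₁ ^ k) hτ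
  have he0 : ∀ w, φ w ∈ G ⊓ h.ker → e w 0 = 0 := fun w hw => by
    have := he w 0
    rw [((mem _).1 hw).2, Equiv.Perm.inv_eq_iff_eq] at this
    simpa using this.symm
  have hrange : ψ.range = G ⊓ h.ker :=
    range_eq_of_cocycle (hφ ▸ inf_le_left) (fun i => hψ i ▸ hb i) hp hτ (ω₀ := (0 : ℤ))
      (zpow_zero _) he0
  refine ⟨_, inferInstance, ψ, hrange, ?_⟩
  refine hfill.push hN hP hA hp hτ (ω₀ := (0 : ℤ)) (c₁ := d * N t₁) (zpow_zero _) ?_ ?_ ?_ 2 ?_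
  · intro r hr
    ext k
    have := he r k
    rw [hr, Equiv.Perm.inv_eq_iff_eq] at this
    simpa using this.symm
  · intro i
    have hi := hb i
    obtain ⟨u, hu⟩ : b i ∈ φ.range := hφ ▸ ((mem _).1 hi).1
    exact ⟨u, hu.trans (hψ i).symm, he0 u (hu ▸ hi)⟩
  · intro x
    rw [he, zero_add, mul_right_comm]
    refine (hN.zpow _ _).trans (Nat.mul_le_mul_right _ ((hd _ (hφG x)).trans ?_))
    exact Nat.mul_le_mul_left _ (Nat.le_succ _)
  intro r hr
  obtain ⟨I, q, S, hI, hq⟩ := exists_powerSystem ψ hN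
  rw [hrange] at S
  let push : FreeGroup X → slowSeq ψ hN := fun w => ⟨fun k => p k w,
      2 * N t₁ + N (φ w) + (h (φ w)).toAdd.natAbs * N t₁, fun k => by
    rw [hτ', he]
    have h1 := hN.zpow t₁ k
    have h2 := hN.zpow t₁ (k + (h (φ w)).toAdd)
    have h3 := Nat.mul_le_mul_right (N t₁) (Int.natAbs_add_le k (h (φ w)).toAdd)
    refine ((hN.mul _ _).trans (add_le_add (hN.mul _ _) (hN.inv _).le)).trans ?_
    generalize k.natAbs = a at *
    nlinarith [Nat.zero_le (a * (N (φ w) + (h (φ w)).toAdd.natAbs * N t₁))]⟩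
  let step : ℤ → X → slowSeq ψ hN := fun m x =>
    powSeq ψ hN c * constSeq ψ hN (c ^ m) * (powSeq ψ hN (z x) * constSeq ψ hN (z x ^ m)) *
      constSeq ψ hN (κ x)
  have hstep : ∀ (k m : ℤ) x, (step m x).1 k = p (k + m) (.of x) := fun k m x => by
    rw [hpx, zpow_add, zpow_add]
    rfl
  have hstep' : ∀ g x, g ∈ G → normalForm h t₁ t₂ I q g *
      (step (h g).toAdd x : slowSeq ψ hN ⧸ nullSeq ψ hN) =
        normalForm h t₁ t₂ I q (g * φ (.of x)) := by
    intro g x hg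
    rw [← S.normalForm_mul rfl ht₁ ht₂ ht₃ hh₁ hh₂ hh₃ h12 h13 h23 hg (hφG (.of x))]
    simp only [step, QuotientGroup.mk_mul, hI, hq]
    simp only [map_zpow, c, z, κ, hψ]
    rfl
  have hpush : ∀ w, (push w : slowSeq ψ hN ⧸ nullSeq ψ hN) = normalForm h t₁ t₂ I q (φ w) := by
    intro w
    refine fgNorm_induction (Q := fun w _ => (push w : slowSeq ψ hN ⧸ nullSeq ψ hN) =
      normalForm h t₁ t₂ I q (φ w)) ?_ ?_ ?_ w
    · rw [map_one, S.normalForm_one (hb none)]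
      have : push 1 = 1 := Subtype.ext (funext fun k => hp.one k)
      rw [this, QuotientGroup.mk_one]
    · intro w _ x ih
      have : push (w * .of x) = push w * step (h (φ w)).toAdd x := Subtype.ext (funext fun k => by
        rw [Subgroup.coe_mul, Pi.mul_apply, hstep, ← he]
        exact hp k w (.of x))
      rw [this, QuotientGroup.mk_mul, ih, hstep' _ _ (hφG w), map_mul]
    · intro w _ x ih
      have : push (w * (.of x)⁻¹) * step (h (φ (w * (.of x)⁻¹))).toAdd x = push w :=
        Subtype.ext (funext fun k => by
          rw [Subgroup.coe_mul, Pi.mul_apply, hstep, ← he]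
          exact hp.mul_of_inv k w (.of x))
      rw [← this, QuotientGroup.mk_mul, ← eq_mul_inv_iff_mul_eq] at ih
      rw [ih, mul_inv_eq_iff_eq_mul, hstep' _ _ (hφG _), ← map_mul, inv_mul_cancel_right]
  have hnull : push r ∈ nullSeq ψ hN := by
    rw [← QuotientGroup.eq_one_iff, hpush, hr, S.normalForm_one (hb none)]
  obtain ⟨R, hR, hR1, c', hc'⟩ := hnull
  refine ⟨R, hR, hR1, c' * (d + 1) ^ 2, fun n hn x hx => ?_⟩
  have hk : ((e x)⁻¹ 0).natAbs + 1 ≤ (d + 1) * n := by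
    rw [he, zero_add]
    have := (hd _ (hφG x)).trans (Nat.mul_le_mul_left d hx)
    nlinarith
  refine (hc' ((e x)⁻¹ 0)).mono subset_rfl (fun y hy => ?_) ?_
  · refine le_trans (show N (ψ y) ≤ _ from hy) ((Nat.mul_le_mul_left c' hk).trans ?_)
    rw [← mul_assoc]
    exact Nat.mul_le_mul_right _ (Nat.mul_le_mul_left _ (Nat.le_self_pow two_ne_zero _))
  · rw [mul_assoc, ← mul_pow]
    exact Nat.mul_le_mul_left _ (Nat.pow_le_pow_left hk 2)

end Kernel

section Product

open FreeGroup (mk of)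

variable {n : ℕ} {X : Fin n → Type}

theorem fgNorm_letter_induction {X : Type} {Q : FreeGroup X → ℕ → Prop} (one : Q 1 0)
    (letter : ∀ w n p, Q w n → Q (w * mk [p]) (n + 1)) (w : FreeGroup X) : Q w (fgNorm w) :=
  fgNorm_induction one (fun w n x => letter w n (x, true)) (fun w n x => letter w n (x, false)) w

theorem fgNorm_mk_singleton {X : Type} (p : X × Bool) : fgNorm (mk [p]) ≤ 1 := by
  rcases p with ⟨x, _ | _⟩
  · exact ((fgNorm_inv (of x)).trans (fgNorm_of x)).le
  · exact (fgNorm_of x).le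

/-- The endomorphism deleting the letters whose index is not in `s`. -/
def retract (s : Finset (Fin n)) : FreeGroup (Σ i, X i) →* FreeGroup (Σ i, X i) :=
  FreeGroup.lift fun x => if x.1 ∈ s then of x else 1

theorem retract_letter (s : Finset (Fin n)) (p : (Σ i, X i) × Bool) :
    retract s (mk [p]) = if p.1.1 ∈ s then mk [p] else 1 := by
  have h : ∀ x : Σ i, X i, retract s (of x) = if x.1 ∈ s then of x else 1 :=
    fun x => FreeGroup.lift_apply_of
  rcases p with ⟨x, _ | _⟩
  · change retract s (of x)⁻¹ = if x.1 ∈ s then (of x)⁻¹ else 1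
    rw [map_inv, h]
    split_ifs <;> simp
  · exact h x

theorem fgNorm_retract (s : Finset (Fin n)) (w : FreeGroup (Σ i, X i)) :
    fgNorm (retract s w) ≤ fgNorm w := by
  refine fgNorm_letter_induction (Q := fun w n => fgNorm (retract s w) ≤ n) (by simp [fgNorm_one])
    ?_ w
  intro w n p ih
  rw [map_mul, retract_letter]
  refine (fgNorm_mul _ _).trans (add_le_add ih ?_)
  split_ifs
  · exact fgNorm_mk_singleton p
  · simp [fgNorm_one]

/-- Commutators of letters with different indices. -/
def commRel (X : Fin n → Type) : Set (FreeGroup (Σ i, X i)) :=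
  {r | ∃ p q : (Σ i, X i) × Bool, p.1.1 ≠ q.1.1 ∧ r = mk [p] * mk [q] * (mk [p])⁻¹ * (mk [q])⁻¹}

theorem finite_commRel [∀ i, Finite (X i)] : (commRel X).Finite := by
  refine (Set.finite_range fun pq : ((Σ i, X i) × Bool) × ((Σ i, X i) × Bool) =>
    mk [pq.1] * mk [pq.2] * (mk [pq.1])⁻¹ * (mk [pq.2])⁻¹).subset ?_
  rintro _ ⟨p, q, _, rfl⟩
  exact ⟨(p, q), rfl⟩

theorem fill_retract_commutator {s : Finset (Fin n)} {q : (Σ i, X i) × Bool} (hq : q.1.1 ∉ s)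
    {L : ℕ} (w : FreeGroup (Σ i, X i)) (hL : fgNorm w ≤ L) :
    Fill (commRel X) {x | fgNorm x ≤ L} (fgNorm w)
      (retract s w * mk [q] * (retract s w)⁻¹ * (mk [q])⁻¹) := by
  refine (fgNorm_letter_induction (Q := fun w n => n ≤ L → fgNorm (retract s w) ≤ n ∧
    Fill (commRel X) {x | fgNorm x ≤ L} n
      (retract s w * mk [q] * (retract s w)⁻¹ * (mk [q])⁻¹)) ?_ ?_ w hL).2
  · intro _
    refine ⟨by simp [fgNorm_one], ?_⟩
    rw [map_one, one_mul, inv_one, mul_one, mul_inv_cancel]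
    exact .one 0
  · intro w m p ih hm
    obtain ⟨ih1, ih2⟩ := ih (by omega)
    rw [map_mul, retract_letter]
    split_ifs with hp
    · refine ⟨(fgNorm_mul _ _).trans (add_le_add ih1 (fgNorm_mk_singleton p)), ?_⟩
      have hpq : mk [p] * mk [q] * (mk [p])⁻¹ * (mk [q])⁻¹ ∈ commRel X :=
        ⟨p, q, fun h => hq (h ▸ hp), rfl⟩
      have hw : retract s w ∈ {x : FreeGroup (Σ i, X i) | fgNorm x ≤ L} :=
        ih1.trans (by omega)
      convert Fill.cons (Or.inl hpq) hw ih2 using 1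
      group
    · rw [mul_one]
      exact ⟨by omega, ih2.mono subset_rfl subset_rfl (Nat.le_succ m)⟩

theorem fill_retract_insert {s : Finset (Fin n)} {i : Fin n} (hi : i ∉ s)
    (w : FreeGroup (Σ i, X i)) {L : ℕ} (hL : fgNorm w ≤ L) :
    Fill (commRel X) {x | fgNorm x ≤ 2 * L} (fgNorm w * L)
      (retract (insert i s) w * (retract {i} w * retract s w)⁻¹) := by
  refine (fgNorm_letter_induction (Q := fun w n => n ≤ L → fgNorm w ≤ n ∧
    Fill (commRel X) {x | fgNorm x ≤ 2 * L} (n * L)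
      (retract (insert i s) w * (retract {i} w * retract s w)⁻¹)) ?_ ?_ w hL).2
  · intro _
    simpa [fgNorm_one] using Fill.one (R := commRel X) 0
  · intro w m p ih hm
    obtain ⟨ih1, ih2⟩ := ih (by omega)
    refine ⟨(fgNorm_mul _ _).trans (add_le_add ih1 (fgNorm_mk_singleton p)), ?_⟩
    rw [add_mul, one_mul, map_mul, map_mul, map_mul, retract_letter, retract_letter,
      retract_letter]
    by_cases hp : p.1.1 = i
    · have hps : p.1.1 ∉ s := hp ▸ hi
      have h1 := ih2.mul (((fill_retract_commutator (L := L) hps w (ih1.trans (by omega))).conj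
        (y := retract {i} w) (S' := {x | fgNorm x ≤ 2 * L}) fun x hx => ?_).mono subset_rfl
        subset_rfl (ih1.trans (show m ≤ L by omega)))
      · rw [if_pos (by simp [hp]), if_pos (by simp [hp]), if_neg hps, mul_one]
        simpa [mul_assoc] using h1
      · have hx' : fgNorm x ≤ L := hx
        have := fgNorm_retract {i} w
        exact (fgNorm_mul _ _).trans (by omega)
    · rw [if_neg (show p.1.1 ∉ ({i} : Finset (Fin n)) by simpa using hp)]
      by_cases hps : p.1.1 ∈ s
      · rw [if_pos (by simp [hps]), if_pos hps]
        rw [mul_one, ← mul_assoc, mul_inv_rev, mul_inv_rev, mul_assoc (retract (insert i s) w),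
          mul_inv_cancel_left, ← mul_inv_rev]
        exact ih2.mono subset_rfl subset_rfl (Nat.le_add_right _ L)
      · rw [if_neg (by simp [hps, hp]), if_neg hps]
        simpa using ih2.mono subset_rfl subset_rfl (Nat.le_add_right _ L)

theorem fill_of_fill_retract {R : Set (FreeGroup (Σ i, X i))} (hR : commRel X ⊆ R)
    (w : FreeGroup (Σ i, X i)) {L K a : ℕ} (hL : fgNorm w ≤ L) (hK : 2 * L ≤ K) (ha : L ^ 2 ≤ a)
    (h : ∀ i, Fill R {x | fgNorm x ≤ K} a (retract {i} w)) :
    Fill R {x | fgNorm x ≤ K} (n * (2 * a)) w := by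
  have key : ∀ s : Finset (Fin n), Fill R {x | fgNorm x ≤ K} (s.card * (2 * a)) (retract s w) := by
    intro s
    induction s using Finset.induction_on with
    | empty =>
      have : retract (∅ : Finset (Fin n)) = (1 : FreeGroup (Σ i, X i) →* _) :=
        FreeGroup.ext_hom _ _ fun x => by simp [retract]
      rw [this]
      exact .one _
    | insert i s hi ih =>
      have h1 := ((fill_retract_insert hi w hL).mono hR (fun x hx => le_trans hx hK)
        (m := a) (by nlinarith)).mul ((h i).mul ih)
      rw [inv_mul_cancel_right] at h1
      rw [Finset.card_insert_of_notMem hi]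
      exact h1.mono subset_rfl subset_rfl (by linarith)
  have huniv : retract (Finset.univ : Finset (Fin n)) = MonoidHom.id (FreeGroup (Σ i, X i)) :=
    FreeGroup.ext_hom _ _ fun x => by simp [retract]
  simpa [huniv] using key Finset.univ

end Product

theorem exists_isLength {X : Type} {E : Type*} [Group E] (φ : FreeGroup X →* E)
    (hφ : Function.Surjective φ) :
    ∃ N : E → ℕ, IsLength N ∧ (∀ w, N (φ w) ≤ fgNorm w) ∧ ∀ g, ∃ w, φ w = g ∧ fgNorm w ≤ N g := by
  let N : E → ℕ := fun g => sInf {k | ∃ w, φ w = g ∧ fgNorm w = k}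
  have h1 : ∀ w, N (φ w) ≤ fgNorm w := fun w => Nat.sInf_le ⟨w, rfl, rfl⟩
  have h2 : ∀ g, ∃ w, φ w = g ∧ fgNorm w = N g := by
    intro g
    obtain ⟨w, hw⟩ := hφ g
    exact Nat.sInf_mem (s := {k | ∃ w, φ w = g ∧ fgNorm w = k}) ⟨_, w, hw, rfl⟩
  have hinv : ∀ g, N g⁻¹ ≤ N g := by
    intro g
    obtain ⟨w, rfl, hw⟩ := h2 g
    rw [← map_inv, ← hw, ← fgNorm_inv w]
    exact h1 _
  refine ⟨N, ⟨?_, fun g => (hinv g).antisymm ?_, fun g h => ?_⟩, h1, fun g => ?_⟩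
  · have := h1 1
    rw [map_one, fgNorm_one] at this
    exact Nat.le_zero.mp this
  · simpa using hinv g⁻¹
  · obtain ⟨v, rfl, hv⟩ := h2 g
    obtain ⟨w, rfl, hw⟩ := h2 h
    rw [← map_mul, ← hv, ← hw]
    exact (h1 _).trans (fgNorm_mul v w)
  · obtain ⟨w, hw, hw'⟩ := h2 g
    exact ⟨w, hw, hw'.le⟩

theorem fgNorm_map_le {X Y : Type} (f : X → Y) (w : FreeGroup X) :
    fgNorm (FreeGroup.map f w) ≤ fgNorm w := by
  refine fgNorm_letter_induction (Q := fun w n => fgNorm (FreeGroup.map f w) ≤ n)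
    (by simp [fgNorm_one]) (fun w n p ih => ?_) w
  rw [map_mul]
  exact (fgNorm_mul _ _).trans (add_le_add ih (fgNorm_mk_singleton (f p.1, p.2)))

section Base

variable {n : ℕ} {X : Fin n → Type}

/-- The projection onto the letters with index `i`. -/
def letterProj (i : Fin n) : FreeGroup (Σ i, X i) →* FreeGroup (X i) :=
  FreeGroup.lift fun x => if h : x.1 = i then FreeGroup.of (h ▸ x.2) else 1

theorem fgNorm_letterProj (i : Fin n) (w : FreeGroup (Σ i, X i)) :
    fgNorm (letterProj i w) ≤ fgNorm w := by
  have h : ∀ x : Σ i, X i, fgNorm (letterProj i (FreeGroup.of x)) ≤ 1 := by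
    intro x
    rw [letterProj, FreeGroup.lift_apply_of]
    split_ifs
    · exact (fgNorm_of _).le
    · simp [fgNorm_one]
  refine fgNorm_induction (Q := fun w n => fgNorm (letterProj i w) ≤ n)
    (by simp [fgNorm_one]) (fun w n x ih => ?_) (fun w n x ih => ?_) w
  · rw [map_mul]
    exact (fgNorm_mul _ _).trans (add_le_add ih (h x))
  · rw [map_mul, map_inv]
    exact (fgNorm_mul _ _).trans (add_le_add ih ((fgNorm_inv _).trans_le (h x)))

theorem retract_singleton (i : Fin n) (w : FreeGroup (Σ i, X i)) :
    retract {i} w = FreeGroup.map (Sigma.mk i) (letterProj i w) := by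
  have : retract {i} = (FreeGroup.map (Sigma.mk i)).comp (letterProj (X := X) i) := by
    refine FreeGroup.ext_hom _ _ fun x => ?_
    obtain ⟨j, x⟩ := x
    by_cases h : j = i
    · subst h
      simp [retract, letterProj]
    · simp [retract, letterProj, h]
  rw [this]
  rfl

variable {Γ : Fin n → Type} [∀ i, Group (Γ i)]

/-- The homomorphism from the free group on the disjoint union of the generating families. -/
def piHom (φ : ∀ i, FreeGroup (X i) →* Γ i) : FreeGroup (Σ i, X i) →* ∀ i, Γ i :=
  FreeGroup.lift fun x => MonoidHom.mulSingle Γ x.1 (φ x.1 (FreeGroup.of x.2))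

theorem piHom_map (φ : ∀ i, FreeGroup (X i) →* Γ i) (i : Fin n) (w : FreeGroup (X i)) :
    piHom φ (FreeGroup.map (Sigma.mk i) w) = MonoidHom.mulSingle Γ i (φ i w) := by
  have : (piHom φ).comp (FreeGroup.map (Sigma.mk i)) = (MonoidHom.mulSingle Γ i).comp (φ i) :=
    FreeGroup.ext_hom _ _ fun x => by simp [piHom]
  exact DFunLike.congr_fun this w

theorem piHom_apply (φ : ∀ i, FreeGroup (X i) →* Γ i) (i : Fin n) (w : FreeGroup (Σ i, X i)) :
    piHom φ w i = φ i (letterProj i w) := by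
  have : (Pi.evalMonoidHom Γ i).comp (piHom φ) = (φ i).comp (letterProj i) := by
    refine FreeGroup.ext_hom _ _ fun x => ?_
    obtain ⟨j, x⟩ := x
    by_cases h : j = i
    · subst h
      simp [piHom, letterProj]
    · simp [piHom, letterProj, h]
  exact DFunLike.congr_fun this w

theorem piHom_surjective {φ : ∀ i, FreeGroup (X i) →* Γ i}
    (hφ : ∀ i, Function.Surjective (φ i)) : Function.Surjective (piHom φ) := by
  rw [← MonoidHom.range_eq_top, eq_top_iff]
  intro g _
  refine Subgroup.pi_mem_of_mulSingle_mem g fun i => ?_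
  obtain ⟨w, hw⟩ := hφ i (g i)
  exact ⟨_, (piHom_map φ i w).trans (by rw [hw]; rfl)⟩

theorem piHom_commRel (φ : ∀ i, FreeGroup (X i) →* Γ i) {r : FreeGroup (Σ i, X i)}
    (hr : r ∈ commRel X) : piHom φ r = 1 := by
  have key : ∀ p : (Σ i, X i) × Bool, ∃ g, piHom φ (FreeGroup.mk [p]) =
      MonoidHom.mulSingle Γ p.1.1 g := by
    intro p
    exact ⟨_, piHom_map φ p.1.1 (FreeGroup.mk [(p.1.2, p.2)])⟩
  obtain ⟨p, q, hpq, rfl⟩ := hr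
  obtain ⟨g, hg⟩ := key p
  obtain ⟨h, hh⟩ := key q
  rw [map_mul, map_mul, map_mul, map_inv, map_inv, hg, hh, mul_inv_eq_one, mul_inv_eq_iff_eq_mul]
  exact Pi.mulSingle_commute hpq g h

theorem fillsWith_piHom [∀ i, Finite (X i)] {φ : ∀ i, FreeGroup (X i) →* Γ i}
    {R : ∀ i, Set (FreeGroup (X i))} (hR : ∀ i, (R i).Finite) (hφ : ∀ i, Presents (R i) (φ i))
    {α ρ : Fin n → ℕ → ℕ} (har : ∀ i, IsAreaRadiusPair (R i) (α i) (ρ i))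
    {N : (∀ i, Γ i) → ℕ} (hN : ∀ w, N (piHom φ w) ≤ fgNorm w) :
    FillsWith (piHom φ) N (fun l => max (l ^ 2) (Finset.univ.sup fun i => α i l))
      (fun l => max l (Finset.univ.sup fun i => ρ i l)) := by
  refine ⟨(⋃ i, FreeGroup.map (Sigma.mk i) '' R i) ∪ commRel X,
    (Set.finite_iUnion fun i => (hR i).image _).union finite_commRel, ?_, 2 * n + 2, ?_⟩
  · rintro r (hr | hr)
    · obtain ⟨i, r, hri, rfl⟩ := Set.mem_iUnion.mp hr
      have : φ i r = 1 := by
        rw [← MonoidHom.mem_ker, (hφ i).2]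
        exact Subgroup.subset_normalClosure hri
      rw [piHom_map, this, map_one]
    · exact piHom_commRel φ hr
  intro L w hw hL
  set A := max (L ^ 2) (Finset.univ.sup fun i => α i L) with hA
  set P := max L (Finset.univ.sup fun i => ρ i L) with hP
  have hwL : fgNorm w ≤ L := by nlinarith
  refine (fill_of_fill_retract (K := 2 * P) (a := A) Set.subset_union_right w hwL
    (Nat.mul_le_mul_left 2 (le_max_left _ _)) (le_max_left _ _) fun i => ?_).mono subset_rfl
    (fun x hx => ?_) (by nlinarith)
  · have h1 : letterProj i w ∈ normalClosure (R i) := by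
      rw [← (hφ i).2, MonoidHom.mem_ker, ← piHom_apply, hw]
      rfl
    obtain ⟨l, hl, hl', hlw⟩ := har i _ h1 L ((fgNorm_letterProj i w).trans hwL)
    have hα : α i L ≤ A :=
      (Finset.le_sup (f := fun i => α i L) (Finset.mem_univ i)).trans (le_max_right _ _)
    have hρ : ρ i L ≤ P :=
      (Finset.le_sup (f := fun i => ρ i L) (Finset.mem_univ i)).trans (le_max_right _ _)
    have h2 := Fill.of_list (R := R i) (S := {x | fgNorm x ≤ ρ i L}) l hl'
    rw [hlw] at h2
    rw [retract_singleton]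
    refine (h2.bind (f := FreeGroup.map (Sigma.mk i)) (m := 1) (map_one _)
      (fun _ _ _ _ _ => map_mul _ _ _) fun x hx r hr => ?_).mono subset_rfl subset_rfl
      (by rw [mul_one]; exact hl.trans hα)
    rw [map_mul, map_mul, map_inv]
    have hx' : fgNorm x ≤ ρ i L := hx
    have hx2 : fgNorm (FreeGroup.map (Sigma.mk (β := X) i) x) ≤ 2 * P :=
      (fgNorm_map_le _ x).trans (by omega)
    refine .single ?_ hx2
    rw [← map_inv]
    exact hr.imp (fun h => .inl (Set.mem_iUnion.mpr ⟨i, _, h, rfl⟩))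
      (fun h => .inl (Set.mem_iUnion.mpr ⟨i, _, h, rfl⟩))
  · have hx' : fgNorm x ≤ 2 * P := hx
    exact (hN x).trans (hx'.trans (Nat.mul_le_mul_right P (by omega)))

theorem exists_hasFill_pi (α ρ : Fin n → ℕ → ℕ)
    (hAR : ∀ i, ∃ (X : Type) (_ : Finite X) (R : Set (FreeGroup X)) (φ : FreeGroup X →* Γ i),
      R.Finite ∧ Presents R φ ∧ IsAreaRadiusPair R (α i) (ρ i)) :
    ∃ (X : Type) (_ : Finite X) (φ : FreeGroup X →* ∀ i, Γ i) (N : (∀ i, Γ i) → ℕ), IsLength N ∧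
      (∀ g, ∃ w, φ w = g ∧ fgNorm w ≤ N g) ∧
      HasFill ⊤ N (fun l => max (l ^ 2) (Finset.univ.sup fun i => α i l))
        (fun l => max l (Finset.univ.sup fun i => ρ i l)) := by
  choose X hX R φ hR hφ har using hAR
  have hs : Function.Surjective (piHom φ) := piHom_surjective fun i => (hφ i).1
  obtain ⟨N, hN, hN1, hN2⟩ := exists_isLength _ hs
  exact ⟨_, inferInstance, piHom φ, N, hN, hN2, _, inferInstance, piHom φ,
    MonoidHom.range_eq_top.mpr hs, fillsWith_piHom hR hφ har hN1⟩

end Base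

section Isoperimetric

variable {X : Type}

theorem area_le_of_fill {R S : Set (FreeGroup X)} {n : ℕ} {w : FreeGroup X} (h : Fill R S n w) :
    area R w ≤ n := by
  obtain ⟨L, hL, hR, hw⟩ := h.exists_list
  exact (Nat.sInf_le (s := {k | ExprOf R w k}) ⟨L, rfl, hR, hw⟩).trans hL

theorem exists_fill_of_mem_normalClosure {R : Set (FreeGroup X)} {w : FreeGroup X}
    (hw : w ∈ normalClosure R) : ∃ n, Fill R Set.univ n w := by
  induction hw using Subgroup.closure_induction with
  | mem x hx =>
    obtain ⟨r, hr, hx⟩ := Group.mem_conjugatesOfSet_iff.mp hx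
    obtain ⟨c, rfl⟩ := isConj_iff.mp hx
    exact ⟨1, .single (.inl hr) trivial⟩
  | one => exact ⟨0, .one 0⟩
  | mul x y _ _ hx hy =>
    obtain ⟨a, ha⟩ := hx
    obtain ⟨b, hb⟩ := hy
    exact ⟨_, ha.mul hb⟩
  | inv x _ hx =>
    obtain ⟨a, ha⟩ := hx
    exact ⟨_, ha.inv⟩

theorem exists_area_le_mul {R T : Set (FreeGroup X)} (hT : T.Finite)
    (hTR : T ⊆ normalClosure R) :
    ∃ M, ∀ S n w, Fill T S n w → area R w ≤ n * M := by
  choose! m hm using fun t (ht : t ∈ T) => exists_fill_of_mem_normalClosure (hTR ht)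
  obtain ⟨M, hM⟩ := (hT.image m).bddAbove
  have hM' : ∀ t ∈ T, Fill R Set.univ M t := fun t ht =>
    (hm t ht).mono subset_rfl subset_rfl (hM ⟨t, ht, rfl⟩)
  refine ⟨M, fun S n w h => area_le_of_fill (S := Set.univ) ?_⟩
  refine h.bind (f := id) rfl (fun _ _ _ _ _ => rfl) fun x _ r hr => ?_
  have h1 : Fill R Set.univ M r := by
    rcases hr with hr | hr
    · exact hM' r hr
    · simpa using (hM' _ hr).inv
  exact h1.conj fun _ _ => trivial

theorem dehn_le {R : Set (FreeGroup X)} {l b : ℕ}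
    (h : ∀ w ∈ normalClosure R, fgNorm w ≤ l → area R w ≤ b) : dehn R l ≤ b := by
  refine csSup_le' ?_
  rintro _ ⟨w, hw, hl, rfl⟩
  exact h w hw hl

theorem HasFill.isIsopFunction {E : Type} [Group E] {H K : Subgroup E} (hKH : K ≤ H)
    (hK : (K.subgroupOf H).FiniteIndex) {N : E → ℕ} {A P : ℕ → ℕ}
    (h : HasFill K N A P) : IsIsopFunction H A := by
  intro X R φ _ _ hφ
  obtain ⟨B, _, ψ, hψ, RB, hRB, hRB1, C, hC⟩ := h
  obtain ⟨Ω, _, e, τ, ω₀, hω₀, he, -, hτ⟩ := exists_coset_action (φ := φ) (K.subgroupOf H)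
  have hS : ∀ ω x, ∃ u, ψ u =
      ↑(τ ω * φ (FreeGroup.of x) * (τ ((e (FreeGroup.of x))⁻¹ ω))⁻¹) := fun ω x => by
    have := mem_subgroupOf.mp (hτ ω (FreeGroup.of x))
    rwa [← hψ] at this
  choose S hS using hS
  obtain ⟨p, hp, hpx⟩ := exists_cocycle e S
  have hψH : ∀ b, ψ (FreeGroup.of b) ∈ H := fun b => hKH (hψ ▸ ⟨_, rfl⟩)
  choose β hβ using fun b => hφ.1 ⟨_, hψH b⟩
  let f : FreeGroup B →* FreeGroup X := FreeGroup.lift β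
  have hf : ∀ u, (φ (f u) : E) = ψ u := by
    intro u
    have : (H.subtype.comp φ).comp f = ψ := FreeGroup.ext_hom _ _ fun b => by simp [f, hβ]
    exact DFunLike.congr_fun this u
  choose σ hσ using fun ω => hφ.1 (τ ω)
  have hp1 : IsCocycle e fun ω w => f (p ω w) := fun ω u v => by
    simp only [← map_mul]; rw [hp]
  have hp2 : IsCocycle e fun ω w =>
      ((σ ω₀)⁻¹ * σ ω) * w * ((σ ω₀)⁻¹ * σ ((e w)⁻¹ ω))⁻¹ := fun ω u v => by
    simp only [map_mul, mul_inv_rev, Equiv.Perm.mul_apply]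
    group
  obtain ⟨R₃, hR₃, hR₃1, _, hcmp⟩ := hp1.exists_fill_compare hp2 φ (fun ω x => by
    apply Subtype.ext
    rw [hf, hpx, hS]
    simp [hσ, hω₀]) (N := fun _ => 0) ⟨rfl, fun _ => rfl, fun _ _ => le_rfl⟩
  obtain ⟨M, hM⟩ := exists_area_le_mul (R := R) (T := f '' RB ∪ R₃) ((hRB.image f).union hR₃) (by
    rw [← hφ.2]
    rintro _ (⟨r, hr, rfl⟩ | hr)
    · exact Subtype.ext ((hf r).trans (hRB1 r hr))
    · exact hR₃1 _ hr)
  obtain ⟨c, hc⟩ := hp.exists_le_fgNorm isLength_fgNorm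
  refine ⟨C * (c + 1) + C * M + M, fun l => dehn_le fun w hw hl => ?_⟩
  set D := C * (c + 1) + C * M + M with hD
  have hw1 : φ w = 1 := by rwa [← hφ.2, MonoidHom.mem_ker] at hw
  have hpw : ψ (p ω₀ w) = 1 := by
    rw [← hf]
    have := hp1.map_eq φ φ τ (fun ω x => by
      apply Subtype.ext
      rw [hf, hpx, hS]) ω₀ w
    rw [this, he w hw1, hw1]
    simp
  have h1 := (hC (D * l + D) _ hpw (by
    have := hc ω₀ w
    have : fgNorm (p ω₀ w) ≤ c * l := this.trans (by gcongr)
    have : C * (c * l + 1) ≤ C * (c + 1) * (l + 1) := by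
      rw [mul_assoc]
      gcongr
      nlinarith
    have : C * (c + 1) * (l + 1) ≤ D * (l + 1) := by gcongr; omega
    calc C * (fgNorm (p ω₀ w) + 1) ≤ C * (c * l + 1) := by gcongr
      _ ≤ D * l + D := by linarith)).bind (R' := f '' RB ∪ R₃) (S' := Set.univ) (m := 1)
      (f := f) (map_one f) (fun _ _ _ _ _ => map_mul _ _ _) fun x _ r hr => by
        rw [map_mul, map_mul, map_inv]
        refine .single ?_ trivial
        rw [← map_inv]
        exact hr.imp (fun h => .inl ⟨_, h, rfl⟩) fun h => .inl ⟨_, h, rfl⟩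
  have h2 := hcmp ω₀ w
  have h3 := ((h2.inv).mono (R' := f '' RB ∪ R₃) (S' := Set.univ) Set.subset_union_right
    (Set.subset_univ _) hl).mul h1
  have h4 : (f (p ω₀ w) * ((σ ω₀)⁻¹ * σ ω₀ * w * ((σ ω₀)⁻¹ * σ ((e w)⁻¹ ω₀))⁻¹)⁻¹)⁻¹ *
      f (p ω₀ w) = w := by
    rw [he w hw1]
    simp
  rw [h4] at h3
  refine (hM _ _ _ h3).trans ?_
  generalize A (D * l + D) = a
  have : C * M * a ≤ D * a := by gcongr; omega
  have : M * l ≤ D * l := by gcongr; omega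
  linarith

end Isoperimetric

section Coordinates

theorem exists_coordinates {Q : Type} [CommGroup Q] [Group.FG Q] {r : ℕ}
    (hrank : Module.rank ℚ (ℚ ⊗[ℤ] Additive Q) = r) :
    ∃ (π : Fin r → Q →* Multiplicative ℤ) (x : Fin r → Q) (m : ℕ), 0 < m ∧
      (∀ a b, π b (x a) = Multiplicative.ofAdd (if a = b then 1 else 0)) ∧
      ∀ z, (∀ a, π a z = 1) → z ^ m = 1 := by
  have : Module.Finite ℤ (Additive Q) := Module.Finite.iff_addGroup_fg.mpr inferInstance
  set T := Submodule.torsion ℤ (Additive Q) with hT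
  have hr : Module.finrank ℤ (Additive Q ⧸ T) = r := by
    have h1 : Module.rank ℤ (Additive Q) = r := by
      rw [← hrank, IsLocalization.rank_eq ℚ (nonZeroDivisors ℤ) le_rfl]
      exact (IsLocalizedModule.rank_eq (nonZeroDivisors ℤ) le_rfl
        (TensorProduct.mk ℤ ℚ (Additive Q) 1)).symm
    rw [Module.finrank, rank_quotient_eq_of_le_torsion le_rfl, h1, Cardinal.toNat_natCast]
  let b := Module.finBasisOfFinrankEq ℤ (Additive Q ⧸ T) hr
  have : Finite T := Module.finite_of_fg_torsion _ Submodule.torsion_isTorsion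
  choose x hx using fun a => Submodule.mkQ_surjective T (b a)
  refine ⟨fun a => MonoidHom.mk' (fun z => .ofAdd (b.repr (T.mkQ (Additive.ofMul z)) a))
    fun y z => ?_, fun a => (x a).toMul, Nat.card T, Nat.card_pos, fun a c => ?_, fun z hz => ?_⟩
  · simp
  · change Multiplicative.ofAdd (b.repr (T.mkQ (x a)) c) = _
    rw [hx, b.repr_self, Finsupp.single_apply]
  · have hzT : Additive.ofMul z ∈ T := by
      rw [← Submodule.ker_mkQ T, LinearMap.mem_ker, ← b.repr.map_eq_zero_iff]
      ext a
      exact hz a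
    have := congrArg Subtype.val (card_nsmul_eq_zero' (x := (⟨_, hzT⟩ : T)))
    exact this

variable {n : ℕ} {Γ : Fin n → Type} [∀ i, Group (Γ i)] {H D' : Subgroup (∀ i, Γ i)}

/-- Up to powers, every element of `D'` is congruent modulo `H` to an element of each factor. -/
theorem exists_pow_eq_of_full {i : Fin n} (hfull : ((MonoidHom.mulSingle Γ i).range ⊔ H).FiniteIndex)
    (hD' : D'.FiniteIndex) {Q : Type} [CommGroup Q] (q : ↥D' →* Q)
    (hqker : q.ker = H.subgroupOf D') (d : D') :
    ∃ m, 0 < m ∧ ∃ g : D', (∀ j, j ≠ i → (g : ∀ i, Γ i) j = 1) ∧ q g = q d ^ m := by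
  obtain ⟨k, hk, -, hdk⟩ := Subgroup.exists_pow_mem_of_index_ne_zero hfull.index_ne_zero
    (d : ∀ i, Γ i)
  have : (MonoidHom.mulSingle Γ i).range.Normal := by
    refine ⟨?_⟩
    rintro _ ⟨x, rfl⟩ g
    refine ⟨g i * x * (g i)⁻¹, ?_⟩
    ext j
    rcases eq_or_ne j i with rfl | hj <;> simp [*]
  obtain ⟨g, ⟨γ, rfl⟩, h, hh, hgh⟩ := Subgroup.mem_sup_of_normal_left.mp hdk
  obtain ⟨e, he, -, hhe⟩ := Subgroup.exists_pow_mem_of_index_ne_zero hD'.index_ne_zero h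
  have hqh : q ⟨h ^ e, hhe⟩ = 1 := by
    rw [← MonoidHom.mem_ker, hqker]
    exact H.pow_mem hh e
  refine ⟨k * e, Nat.mul_pos hk he, d ^ (k * e) * ⟨h ^ e, hhe⟩⁻¹, fun j hj => ?_, ?_⟩
  · simp [pow_mul, ← hgh, hj]
  · rw [map_mul, map_inv, hqh, map_pow]
    simp

theorem exists_dual_system (hfull : ∀ i, ((MonoidHom.mulSingle Γ i).range ⊔ H).FiniteIndex)
    (hD' : D'.FiniteIndex) {Q : Type} [CommGroup Q] [Group.FG Q] (q : ↥D' →* Q)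
    (hq : Function.Surjective q) (hqker : q.ker = H.subgroupOf D') {r : ℕ}
    (hrank : Module.rank ℚ (ℚ ⊗[ℤ] Additive Q) = r) :
    ∃ (D₀ : Subgroup (∀ i, Γ i)) (_ : D₀.FiniteIndex) (θ : Fin r → D₀ →* Multiplicative ℤ)
      (t : Fin n → Fin r → D₀),
      (∀ i a j, j ≠ i → (t i a : ∀ i, Γ i) j = 1) ∧
      (∀ i a b, θ b (t i a) = Multiplicative.ofAdd (if a = b then 1 else 0)) ∧
      ∀ d : D₀, (∀ a, θ a d = 1) ↔ (d : ∀ i, Γ i) ∈ H := by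
  obtain ⟨π, x, m₀, hm₀, hπx, hπ⟩ := exists_coordinates hrank
  choose d hd using fun a => hq (x a)
  choose m hm g hg hgq using fun i a => exists_pow_eq_of_full (hfull i) hD' q hqker (d a)
  set M := m₀ * ∏ i, ∏ a, m i a with hM
  have hMpos : 0 < M := Nat.mul_pos hm₀ (Finset.prod_pos fun i _ => Finset.prod_pos fun a _ => hm i a)
  have hmM : ∀ i a, m i a ∣ M := fun i a =>
    (Finset.dvd_prod_of_mem (fun a => m i a) (Finset.mem_univ a)).trans
      ((Finset.dvd_prod_of_mem (fun i => ∏ a, m i a) (Finset.mem_univ i)).trans (dvd_mul_left _ _))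
  choose k hk using hmM
  let U := ((powMonoidHom (α := Q) M).range.comap q)
  have hU : U.FiniteIndex := by
    have := Subgroup.finiteIndex_range_powMonoidHom_of_fg Q hMpos.ne'
    exact ⟨by rw [Subgroup.index_comap_of_surjective _ hq]; exact this.index_ne_zero⟩
  let D₀ := U.map D'.subtype
  have hD₀ : D₀.FiniteIndex :=
    ⟨by rw [Subgroup.index_map_subtype]; exact mul_ne_zero hU.index_ne_zero hD'.index_ne_zero⟩
  have hle : D₀ ≤ D' := Subgroup.map_subtype_le _
  have hdvd : ∀ d : D₀, ∃ z, q ⟨d, hle d.2⟩ = z ^ M := by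
    rintro ⟨_, u, ⟨z, hz⟩, rfl⟩
    exact ⟨z, hz.symm⟩
  have hdvd' : ∀ (d : D₀) a, (M : ℤ) ∣ (π a (q ⟨d, hle d.2⟩)).toAdd := by
    intro d a
    obtain ⟨z, hz⟩ := hdvd d
    rw [hz, map_pow, toAdd_pow]
    exact ⟨(π a z).toAdd, by simp⟩
  let θ : Fin r → D₀ →* Multiplicative ℤ := fun a =>
    MonoidHom.mk' (fun d => .ofAdd ((π a (q ⟨d, hle d.2⟩)).toAdd / M)) fun d d' => by
      rw [← ofAdd_add, ← Int.add_ediv_of_dvd_left (hdvd' d a), ← toAdd_mul, ← map_mul, ← map_mul]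
      rfl
  have hqt : ∀ i a, q (g i a ^ k i a) = x a ^ M := fun i a => by
    rw [map_pow, hgq, hd, ← pow_mul, ← hk]
  refine ⟨D₀, hD₀, θ, fun i a => ⟨_, ⟨g i a ^ k i a, ⟨x a, (hqt i a).symm⟩, rfl⟩⟩, ?_, ?_, ?_⟩
  · intro i a j hj
    simp [hg i a j hj]
  · intro i a b
    change Multiplicative.ofAdd ((π b (q (g i a ^ k i a))).toAdd / (M : ℤ)) = _
    rw [hqt, map_pow, hπx, toAdd_pow]
    congr 1
    split_ifs <;> simp [hMpos.ne']
  · intro d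
    have hdH : (d : ∀ i, Γ i) ∈ H ↔ q ⟨d, hle d.2⟩ = 1 := by
      rw [← MonoidHom.mem_ker, hqker]
      rfl
    rw [hdH]
    refine ⟨fun h => ?_, fun h a => ?_⟩
    · obtain ⟨z, hz⟩ := hdvd d
      have hz' : z ^ m₀ = 1 := by
        refine hπ z fun a => ?_
        have h1 : (π a (q ⟨d, hle d.2⟩)).toAdd / (M : ℤ) = 0 := congrArg Multiplicative.toAdd (h a)
        rw [hz, map_pow, toAdd_pow, nsmul_eq_mul,
          Int.mul_ediv_cancel_left _ (by exact_mod_cast hMpos.ne')] at h1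
        exact Multiplicative.toAdd.injective h1
      rw [hz, hM, pow_mul, hz', one_pow]
    · change Multiplicative.ofAdd ((π a (q ⟨d, hle d.2⟩)).toAdd / (M : ℤ)) = 1
      rw [h, map_one, toAdd_one, Int.zero_ediv, ofAdd_zero]

end Coordinates

section Chain

variable {E : Type} [Group E] {N : E → ℕ} {A P : ℕ → ℕ} {K : Subgroup E}

theorem HasFill.subtype (h : HasFill K N A P) :
    HasFill (⊤ : Subgroup K) (N ∘ K.subtype) A P := by
  obtain ⟨X, hX, φ, rfl, R, hR, hR1, C, hC⟩ := h
  have h1 : ∀ w, φ.rangeRestrict w = 1 ↔ φ w = 1 := fun w => by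
    rw [← Subtype.coe_inj]
    rfl
  exact ⟨X, hX, φ.rangeRestrict, MonoidHom.range_eq_top.mpr φ.rangeRestrict_surjective, R, hR,
    fun r hr => (h1 r).2 (hR1 r hr), C, fun L w hw hL => hC L w ((h1 w).1 hw) hL⟩

theorem HasFill.map_subtype {G : Subgroup K} (h : HasFill G (N ∘ K.subtype) A P) :
    HasFill (G.map K.subtype) N A P := by
  obtain ⟨X, hX, φ, rfl, R, hR, hR1, C, hC⟩ := h
  exact ⟨X, hX, K.subtype.comp φ, MonoidHom.range_comp K.subtype φ, R, hR,
    fun r hr => by rw [MonoidHom.comp_apply, hR1 r hr, map_one], C,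
    fun L w hw hL => hC L w (K.subtype_injective (hw.trans (map_one _).symm)) hL⟩

theorem HasFill.iInf_ker {ι : Type*} [DecidableEq ι] (hN : IsLength N) (hP : ∀ L, L ≤ P L)
    (hA : ∀ L, L ≤ A L) (h : HasFill (⊤ : Subgroup E) N A P)
    (θ : ι → E →* Multiplicative ℤ) (hθ : ∀ a, ∃ d, ∀ g, (θ a g).toAdd.natAbs ≤ d * N g)
    {t₁ t₂ t₃ : ι → E}
    (ht₁ : ∀ a b, θ b (t₁ a) = Multiplicative.ofAdd (if a = b then 1 else 0))
    (ht₂ : ∀ a b, θ b (t₂ a) = Multiplicative.ofAdd (if a = b then 1 else 0))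
    (ht₃ : ∀ a b, θ b (t₃ a) = Multiplicative.ofAdd (if a = b then 1 else 0))
    (h12 : ∀ a g g', Commute (g * t₁ a * g⁻¹) (g' * t₂ a * g'⁻¹))
    (h13 : ∀ a g g', Commute (g * t₁ a * g⁻¹) (g' * t₃ a * g'⁻¹))
    (h23 : ∀ a g g', Commute (g * t₂ a * g⁻¹) (g' * t₃ a * g'⁻¹)) (s : Finset ι) :
    HasFill (⨅ a ∈ s, (θ a).ker) N (fun L => P L ^ (2 * s.card) * A L) P := by
  induction s using Finset.induction_on with
  | empty => simpa using h
  | insert a s ha ih =>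
    have hA' : ∀ L, L ≤ P L ^ (2 * s.card) * A L := by
      intro L
      rcases Nat.eq_zero_or_pos L with rfl | hL
      · exact Nat.zero_le _
      · exact (hA L).trans (Nat.le_mul_of_pos_left _ (Nat.pow_pos (hL.trans_le (hP L))))
    have hmem : ∀ t, (∀ b, θ b t = Multiplicative.ofAdd (if a = b then 1 else 0)) →
        t ∈ ⨅ b ∈ s, (θ b).ker := by
      intro t ht
      simp only [Subgroup.mem_iInf, MonoidHom.mem_ker]
      intro b hb
      have hab : a ≠ b := fun hab => ha (hab ▸ hb)
      rw [ht, if_neg hab, ofAdd_zero]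
    obtain ⟨d, hd⟩ := hθ a
    have := HasFill.inf_ker hN hP hA' ih (h := θ a) (d := d) (fun g _ => hd g)
      (hmem _ (ht₁ a)) (hmem _ (ht₂ a)) (hmem _ (ht₃ a))
      (by rw [ht₁, if_pos rfl]) (by rw [ht₂, if_pos rfl]) (by rw [ht₃, if_pos rfl])
      (h12 a) (h13 a) (h23 a)
    rw [Finset.iInf_insert, Finset.card_insert_of_notMem ha, inf_comm]
    convert this using 2 with L
    ring

end Chain

theorem commute_of_support {n : ℕ} {Γ : Fin n → Type} [∀ i, Group (Γ i)] {i j : Fin n}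
    (hij : i ≠ j) {x y : ∀ i, Γ i} (hx : ∀ k, k ≠ i → x k = 1) (hy : ∀ k, k ≠ j → y k = 1)
    (g g' : ∀ i, Γ i) : Commute (g * x * g⁻¹) (g' * y * g'⁻¹) := by
  refine Pi.commute_iff.mpr fun k => ?_
  by_cases hk : k = i
  · simp [hy k (hk ▸ hij)]
  · simp [hx k hk]

end IsopProof

/-- If `H` is a virtually-full, virtually-coabelian subgroup of corank `r` of a direct product
of `n ≥ 3` finitely presented groups with area-radius pairs `(αᵢ, ρᵢ)`, then
`l ↦ ρ(l)^{2r}·α(l)` is an isoperimetric function for `H`, where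
`α(l) = max({l²} ∪ {αᵢ(l)})` and `ρ(l) = max({l} ∪ {ρᵢ(l)})`. -/
theorem virtuallyFull_virtuallyCoabelian_isoperimetric
    (n : ℕ) (hn : 3 ≤ n) (Γ : Fin n → Type) [∀ i, Group (Γ i)]
    (H : Subgroup (∀ i, Γ i))
    (hfull : ∀ i, ((MonoidHom.mulSingle Γ i).range ⊔ H).FiniteIndex)
    (D' : Subgroup (∀ i, Γ i)) (hD'fi : D'.FiniteIndex) (hco : ⁅D', D'⁆ ≤ H)
    -- the corank of `H` is `r`: the quotient `D'/(H ∩ D')` has `ℚ`-corank `r`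
    (r : ℕ) (Q : Type) [CommGroup Q] (q : ↥D' →* Q)
    (hqsurj : Function.Surjective q) (hqker : q.ker = H.subgroupOf D')
    (hrank : Module.rank ℚ (ℚ ⊗[ℤ] Additive Q) = r)
    -- area-radius pairs for finite presentations of the factors
    (α ρ : Fin n → ℕ → ℕ)
    (hAR : ∀ i, ∃ (X : Type) (_ : Finite X) (R : Set (FreeGroup X)) (φ : FreeGroup X →* Γ i),
      R.Finite ∧ Presents R φ ∧ IsAreaRadiusPair R (α i) (ρ i)) :
    IsIsopFunction H (fun l =>
      (max l (Finset.univ.sup fun i => ρ i l)) ^ (2 * r) *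
        max (l ^ 2) (Finset.univ.sup fun i => α i l)) := by
  obtain ⟨X, _, φ, N, hN, hNφ, hfill⟩ := IsopProof.exists_hasFill_pi α ρ hAR
  have hD : Group.FG (∀ i, Γ i) := Group.fg_of_surjective (f := φ) fun g =>
    let ⟨w, hw, _⟩ := hNφ g; ⟨w, hw⟩
  have hQ : Group.FG Q := Group.fg_of_surjective hqsurj
  obtain ⟨D₀, hD₀, θ, t, ht, htθ, hθH⟩ :=
    IsopProof.exists_dual_system hfull hD'fi q hqsurj hqker hrank
  have hP : ∀ L, L ≤ max L (Finset.univ.sup fun i => ρ i L) := fun L => le_max_left _ _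
  have hA : ∀ L, L ≤ max (L ^ 2) (Finset.univ.sup fun i => α i L) := fun L =>
    (Nat.le_self_pow two_ne_zero L).trans (le_max_left _ _)
  have hcomm : ∀ i j, i ≠ j → ∀ a (g g' : D₀),
      Commute (g * t i a * g⁻¹) (g' * t j a * g'⁻¹) := fun i j hij a g g' =>
    Subtype.ext (IsopProof.commute_of_support hij (ht i a) (ht j a) g g')
  let i₀ : Fin n := ⟨0, by omega⟩
  let i₁ : Fin n := ⟨1, by omega⟩
  let i₂ : Fin n := ⟨2, by omega⟩
  have key := ((hfill.finiteIndex hN hP hA D₀).subtype.iInf_ker (hN.comp _) hP hA θ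
    (fun a => IsopProof.exists_natAbs_le hNφ D₀ (θ a)) (htθ i₀) (htθ i₁) (htθ i₂)
    (hcomm i₀ i₁ (by simp [i₀, i₁])) (hcomm i₀ i₂ (by simp [i₀, i₂]))
    (hcomm i₁ i₂ (by simp [i₁, i₂])) Finset.univ).map_subtype
  rw [Finset.card_univ, Fintype.card_fin] at key
  have hmap : (⨅ a ∈ Finset.univ, (θ a).ker).map D₀.subtype = H ⊓ D₀ := by
    ext d
    simp only [Subgroup.mem_map, Subgroup.mem_iInf, MonoidHom.mem_ker, Finset.mem_univ,
      forall_const, Subgroup.mem_inf]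
    exact ⟨fun ⟨d', hd', hd⟩ => hd ▸ ⟨(hθH d').1 hd', d'.2⟩,
      fun ⟨hdH, hd⟩ => ⟨⟨d, hd⟩, (hθH ⟨d, hd⟩).2 hdH, rfl⟩⟩
  rw [hmap] at key
  refine key.isIsopFunction inf_le_left ?_
  rw [Subgroup.inf_subgroupOf_left]
  infer_instance
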